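/- arXiv:2407.03464 — 2 statements merged into one kernel-verified Lean document; each statement's English description precedes it below -/
import Mathlib

section
/- Let n ≥ 0 be an integer and let z ∈ ℂ with |Im z| < 1/2. Then for every ε ∈ (0, π), ∫_ℝ e^{−2i(t+iε)z} (t+iε)^{2n−2} / sinh(t+iε) dt = 2·Li_{2−2n}(−e^{2πz})·(πi)^{2n−1}, where Li₂ is the dilogarithm and Li_{2−2n} for n ≥ 1 are the negative-index polylogarithms (the shift by iε realizes the contour ℝ + i0 passing above the origin). -/
open MeasureTheory

noncomputable section

/-- The dilogarithm `Li₂(z) = -∫₀¹ Log(1 - t z) dt / t` (principal branch of `Log`). -/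
def Li2 (z : ℂ) : ℂ := -∫ t in (0:ℝ)..1, Complex.log (1 - (t:ℂ) * z) / (t:ℂ)

/-- Negative-index polylogarithms: `LiNeg m = Li_{-m}`, with `Li₀(w) = w/(1-w)` and
`Li_{-m}(w) = w ⬝ d/dw Li_{-m+1}(w)`. -/
def LiNeg : ℕ → ℂ → ℂ
  | 0 => fun w => w / (1 - w)
  | (m+1) => fun w => w * deriv (LiNeg m) w

/-- `LiIdx n = Li_{2-2n}`: the dilogarithm for `n = 0`, and `Li_{-(2n-2)}` for `n ≥ 1`. -/
def LiIdx (n : ℕ) : ℂ → ℂ := if n = 0 then Li2 else LiNeg (2*n - 2)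

/-- `L_b(z) = i ∫₀^∞ ( sin(2yz)/(2 sinh(y/b) sinh(by)) - z/y ) dy/y`. -/
def Lb (b : ℝ) (z : ℂ) : ℂ :=
  Complex.I * ∫ y in Set.Ioi (0:ℝ),
    (Complex.sin (2 * (y:ℂ) * z) / (2 * (Real.sinh (y / b) : ℂ) * (Real.sinh (b * y) : ℂ))
      - z / (y:ℂ)) / (y:ℂ)

/-- Ruijsenaars' hyperbolic gamma function `s_b(z) = exp(L_b(z))`. -/
def sb (b : ℝ) (z : ℂ) : ℂ := Complex.exp (Lb b z)

/-- `Q = b + b⁻¹` as a complex number. -/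
def Qb (b : ℝ) : ℂ := (b:ℂ) + (b:ℂ)⁻¹

/-- The function `𝓜(b, ζ', ω')`, the contour being the horizontal line `Im = -Q/4`. -/
def Mfun (b : ℝ) (ζ : ℝ) (ω : ℂ) : ℂ :=
  sb b ζ * ∫ x : ℝ,
    Complex.exp (Complex.I * (Real.pi:ℂ) * ((x:ℂ) - Complex.I * Qb b / 4)
        * ((ζ:ℂ) - Complex.I * Qb b / 2 + 2 * ω)) *
      sb b ((x:ℂ) - Complex.I * Qb b / 4 - (ζ:ℂ))
        / sb b ((x:ℂ) - Complex.I * Qb b / 4 + Complex.I * Qb b / 2)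

/-- The exponent `f_𝓜(ζ, ω)`. -/
def fM (ζ : ℝ) (ω : ℂ) : ℂ :=
  -(Li2 (-Complex.exp (2 * (Real.pi:ℂ) * (ζ:ℂ)))
    + Li2 (-(Complex.exp (-((Real.pi:ℂ) * (ζ:ℂ))) * Complex.cosh ((Real.pi:ℂ) * ω)
        / Complex.sinh ((Real.pi:ℂ) * ((ζ:ℂ) + ω))))
    - Li2 (Complex.exp ((Real.pi:ℂ) * (ζ:ℂ)) * Complex.cosh ((Real.pi:ℂ) * ω)
        / Complex.sinh ((Real.pi:ℂ) * ((ζ:ℂ) + ω))))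
    / (2 * (Real.pi:ℂ) * Complex.I)
  + Complex.I * (Real.pi:ℂ) * (ζ:ℂ)^2
  + Complex.I * (ω - Complex.I / 2) *
      Complex.log (Complex.exp ((Real.pi:ℂ) * (ζ:ℂ)) * Complex.cosh ((Real.pi:ℂ) * ω)
        / Complex.sinh ((Real.pi:ℂ) * ((ζ:ℂ) + ω)))
  + Complex.I * (Real.pi:ℂ) / 6

/-- The function `𝓠(b, σ', μ')`, the contour being the horizontal line `Im = -3Q/8`. -/
def Qfun (b : ℝ) (σ μ : ℝ) : ℂ :=
  Complex.exp (Complex.I * (Real.pi:ℂ) *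
      (1/6 + 7 * (Qb b)^2 / 24 - (μ:ℂ)^2/2 + Complex.I * (μ:ℂ) * Qb b - (σ:ℂ)^2)) * sb b μ *
  ∫ x : ℝ,
    Complex.exp (-(Complex.I * (Real.pi:ℂ) * ((x:ℂ) - 3 * Complex.I * Qb b / 8)^2)) *
    Complex.exp (2 * Complex.I * (Real.pi:ℂ) * ((x:ℂ) - 3 * Complex.I * Qb b / 8)
      * ((μ:ℂ) - Complex.I * Qb b / 2)) *
    sb b ((x:ℂ) - 3 * Complex.I * Qb b / 8 + (σ:ℂ)) *
    sb b ((x:ℂ) - 3 * Complex.I * Qb b / 8 - (σ:ℂ))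

/-- The exponent `f_𝓠(σ, μ)`. -/
def fQ (σ μ : ℝ) : ℂ :=
  -(Li2 (-Complex.exp (2 * (Real.pi:ℂ) * (μ:ℂ)))) / (2 * (Real.pi:ℂ) * Complex.I)
  - Li2 (Complex.exp (-(2 * (Real.pi:ℂ) * (σ:ℂ))) *
      ((Real.cosh (2*Real.pi*σ) : ℂ) + Complex.I *
        (Real.sqrt (Real.exp (2*Real.pi*μ) - Real.sinh (2*Real.pi*σ)^2) : ℂ)))
    / (2 * (Real.pi:ℂ) * Complex.I)
  - Li2 (Complex.exp (2 * (Real.pi:ℂ) * (σ:ℂ)) *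
      ((Real.cosh (2*Real.pi*σ) : ℂ) + Complex.I *
        (Real.sqrt (Real.exp (2*Real.pi*μ) - Real.sinh (2*Real.pi*σ)^2) : ℂ)))
    / (2 * (Real.pi:ℂ) * Complex.I)
  + (1/2 + Complex.I * (μ:ℂ)) *
      Complex.log (-(Real.cosh (2*Real.pi*σ) : ℂ) - Complex.I *
        (Real.sqrt (Real.exp (2*Real.pi*μ) - Real.sinh (2*Real.pi*σ)^2) : ℂ))
  - (Real.pi:ℂ) * (μ:ℂ) + 5 * (Real.pi:ℂ) * Complex.I / 12

/-- The phase function `f(t)` of the saddle point analysis of `𝓜`. -/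
def fMt (ζ : ℝ) (ω t : ℂ) : ℂ :=
  -(Li2 (-Complex.exp (2*(Real.pi:ℂ)*(ζ:ℂ)))
    + Li2 (-Complex.exp (2*(Real.pi:ℂ)*(t-(ζ:ℂ))))
    - Li2 (-Complex.exp (2*(Real.pi:ℂ)*(t+Complex.I/2)))) / (2*(Real.pi:ℂ)*Complex.I)
  + Complex.I*(Real.pi:ℂ)*(ζ:ℂ)^2 + 2*Complex.I*(Real.pi:ℂ)*t*ω + (Real.pi:ℂ)*t
  + Complex.I*(Real.pi:ℂ)/6

/-- The amplitude `g(t)` of the saddle point analysis of `𝓜`. -/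
def gM (t : ℂ) : ℂ :=
  Complex.exp ((Real.pi:ℂ)*t - Complex.log (1 - Complex.exp (2*(Real.pi:ℂ)*t)) / 2)

/-- The error term `E(τ, t)` from the semiclassical analysis of `𝓜`. -/
def Efun (ζ τ : ℝ) (t : ℂ) : ℂ :=
  Complex.I * (Li2 (Complex.exp (2*(Real.pi:ℂ)*t))
      - Li2 (Complex.exp (Complex.I*(Real.pi:ℂ)*(τ:ℂ) + 2*(Real.pi:ℂ)*t))) / (2*(Real.pi:ℂ)*(τ:ℂ))
  + Complex.log (1 - Complex.exp (2*(Real.pi:ℂ)*t)) / 2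
  + (Complex.I*(Real.pi:ℂ)*(τ:ℂ)/12) *
      (Complex.exp (2*(Real.pi:ℂ)*t + Complex.I*(Real.pi:ℂ)*(τ:ℂ))
          / (Complex.exp (2*(Real.pi:ℂ)*t + Complex.I*(Real.pi:ℂ)*(τ:ℂ)) - 1)
        - Complex.exp (2*(Real.pi:ℂ)*(ζ:ℂ)) / (Complex.exp (2*(Real.pi:ℂ)*(ζ:ℂ)) + 1)
        - Complex.exp (2*(Real.pi:ℂ)*t)
          / (Complex.exp (2*(Real.pi:ℂ)*(ζ:ℂ)) + Complex.exp (2*(Real.pi:ℂ)*t)) + 2)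

/-- The phase function `f(t)` of the saddle point analysis of `𝓠`. -/
def fQt (σ μ : ℝ) (t : ℂ) : ℂ :=
  -(Li2 (-Complex.exp (2*(Real.pi:ℂ)*(μ:ℂ)))
    + Li2 (-Complex.exp (2*(Real.pi:ℂ)*(t-(σ:ℂ))))
    + Li2 (-Complex.exp (2*(Real.pi:ℂ)*(t+(σ:ℂ))))) / (2*(Real.pi:ℂ)*Complex.I)
  + 2*Complex.I*(Real.pi:ℂ)*(μ:ℂ)*t + (Real.pi:ℂ)*(t-(μ:ℂ)) + 5*Complex.I*(Real.pi:ℂ)/12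

/-- The amplitude `g(t)` of the saddle point analysis of `𝓠`. -/
def gQ (μ : ℝ) (t : ℂ) : ℂ := Complex.exp ((Real.pi:ℂ)*(t-(μ:ℂ)))

end

/-- integrand -/
noncomputable def Fk (k : ℤ) (ε : ℝ) (z : ℂ) (t : ℝ) : ℂ :=
  Complex.exp (-(2*Complex.I*((t:ℂ)+Complex.I*(ε:ℂ))*z)) *
        ((t:ℂ)+Complex.I*(ε:ℂ)) ^ k / Complex.sinh ((t:ℂ)+Complex.I*(ε:ℂ))

lemma norm_sinh_ge (t y : ℝ) :
    Real.cosh t * Real.sin y ≤ ‖Complex.sinh ((t:ℂ)+Complex.I*(y:ℂ))‖ := by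
  have h : Complex.sinh ((t:ℂ)+Complex.I*(y:ℂ)) =
      ((Real.sinh t * Real.cos y : ℝ) : ℂ) + ((Real.cosh t * Real.sin y : ℝ) : ℂ) * Complex.I := by
    rw [mul_comm, Complex.sinh_add, Complex.cosh_mul_I, Complex.sinh_mul_I]
    push_cast; ring
  have him : (Complex.sinh ((t:ℂ)+Complex.I*(y:ℂ))).im = Real.cosh t * Real.sin y := by
    rw [h, Complex.add_im, Complex.ofReal_im, Complex.im_ofReal_mul, Complex.I_im]; ring
  rw [← him]
  exact (le_abs_self _).trans (Complex.abs_im_le_norm _)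

lemma sinh_ne (t y : ℝ) (hy : 0 < Real.sin y) :
    Complex.sinh ((t:ℂ)+Complex.I*(y:ℂ)) ≠ 0 := by
  rw [← norm_pos_iff]
  exact lt_of_lt_of_le (mul_pos (Real.cosh_pos t) hy) (norm_sinh_ge t y)

lemma tI_ne (t y : ℝ) (hy : 0 < y) : (t:ℂ)+Complex.I*(y:ℂ) ≠ 0 := by
  intro h
  have := congrArg Complex.im h
  simp at this
  exact hy.ne' this

lemma half_exp_le_cosh (t : ℝ) : Real.exp |t| / 2 ≤ Real.cosh t := by
  rw [← Real.cosh_abs, Real.cosh_eq]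
  have := Real.exp_pos (-|t|)
  linarith

lemma norm_Fk_le (k : ℤ) (ε : ℝ) (hε : 0 < Real.sin ε) (z : ℂ) (t : ℝ) (β : ℝ) (hz : |z.im| ≤ β) :
    ‖Fk k ε z t‖ ≤ ‖(t:ℂ)+Complex.I*(ε:ℂ)‖ ^ k * Real.exp (2*ε*z.re) *
      (2 / Real.sin ε * Real.exp (-((1-2*β)*|t|))) := by
  unfold Fk
  rw [norm_div, norm_mul, norm_zpow, Complex.norm_exp]
  have hre : (-(2*Complex.I*((t:ℂ)+Complex.I*(ε:ℂ))*z)).re = 2*t*z.im + 2*ε*z.re := by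
    simp
  rw [hre, Real.exp_add]
  have hx : 0 ≤ ‖(t:ℂ)+Complex.I*(ε:ℂ)‖ ^ k := by positivity
  have h1 : t * z.im ≤ |t| * β := by
    calc t * z.im ≤ |t * z.im| := le_abs_self _
      _ = |t| * |z.im| := abs_mul _ _
      _ ≤ |t| * β := by gcongr
  have h2 := norm_sinh_ge t ε
  have h3 := half_exp_le_cosh t
  have h4 : Real.exp |t| / 2 * Real.sin ε ≤ ‖Complex.sinh ((t:ℂ)+Complex.I*(ε:ℂ))‖ :=
    le_trans (by gcongr) h2
  have h5 : Real.exp (2*t*z.im) ≤ Real.exp (2*β*|t|) := Real.exp_le_exp.2 (by nlinarith)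
  calc _ ≤ Real.exp (2*β*|t|) * Real.exp (2*ε*z.re) * ‖(t:ℂ)+Complex.I*(ε:ℂ)‖ ^ k /
        (Real.exp |t| / 2 * Real.sin ε) := by gcongr
    _ = _ := by
      rw [show -((1-2*β)*|t|) = 2*β*|t| - |t| by ring, Real.exp_sub]
      field_simp

lemma norm_zpow_bound (k : ℤ) (ε : ℝ) (hε : 0 < ε) (δ : ℝ) (hδ : 0 < δ) :
    ∃ C, 0 ≤ C ∧ ∀ t : ℝ, ‖(t:ℂ)+Complex.I*(ε:ℂ)‖ ^ k ≤ C * Real.exp (δ * |t|) := by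
  rcases Int.eq_nat_or_neg k with ⟨m, rfl | rfl⟩
  · refine ⟨m.factorial / δ^m * Real.exp (δ*ε), by positivity, fun t => ?_⟩
    have h1 : ‖(t:ℂ)+Complex.I*(ε:ℂ)‖ ≤ |t| + ε := by
      refine (norm_add_le _ _).trans ?_
      simp [abs_of_pos hε]
    have h2 := Real.pow_div_factorial_le_exp (x := δ * (|t| + ε)) (by positivity) m
    rw [zpow_natCast]
    calc _ ≤ (|t| + ε)^m := by gcongr
      _ = m.factorial / δ^m * ((δ * (|t| + ε))^m / m.factorial) := by
        rw [mul_pow]; field_simp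
      _ ≤ m.factorial / δ^m * Real.exp (δ * (|t| + ε)) := by gcongr
      _ = _ := by rw [mul_add, Real.exp_add]; ring
  · refine ⟨(ε^m)⁻¹, by positivity, fun t => ?_⟩
    have h1 : ε ≤ ‖(t:ℂ)+Complex.I*(ε:ℂ)‖ := by
      have := Complex.abs_im_le_norm ((t:ℂ)+Complex.I*(ε:ℂ))
      simp at this
      exact (le_abs_self _).trans this
    rw [zpow_neg, zpow_natCast]
    have : 1 ≤ Real.exp (δ*|t|) := Real.one_le_exp (by positivity)
    calc _ ≤ (ε^m)⁻¹ := by gcongr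
      _ ≤ _ := le_mul_of_one_le_right (by positivity) this

lemma sin_pos_of (ε : ℝ) (hε : ε ∈ Set.Ioo (0:ℝ) Real.pi) : 0 < Real.sin ε :=
  Real.sin_pos_of_mem_Ioo hε

lemma Fk_bound (k : ℤ) (ε : ℝ) (hε : ε ∈ Set.Ioo (0:ℝ) Real.pi) (β : ℝ) (hβ : β < 1/2) :
    ∃ C c : ℝ, 0 ≤ C ∧ 0 < c ∧ ∀ z : ℂ, |z.im| ≤ β → ∀ t : ℝ,
      ‖Fk k ε z t‖ ≤ C * Real.exp (2*ε*z.re) * Real.exp (-(c*|t|)) := by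
  obtain ⟨C, hC, h⟩ := norm_zpow_bound k ε hε.1 ((1-2*β)/2) (by linarith)
  have hs := sin_pos_of ε hε
  refine ⟨C * (2 / Real.sin ε), (1-2*β)/2, by positivity, by linarith, fun z hz t => ?_⟩
  refine (norm_Fk_le k ε hs z t β hz).trans ?_
  calc _ ≤ C * Real.exp ((1-2*β)/2 * |t|) * Real.exp (2*ε*z.re) *
      (2 / Real.sin ε * Real.exp (-((1-2*β)*|t|))) := by
        gcongr; exact h t
    _ = C * (2 / Real.sin ε) * Real.exp (2*ε*z.re) * (Real.exp ((1-2*β)/2 * |t|) * Real.exp (-((1-2*β)*|t|))) := by ring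
    _ = _ := by rw [← Real.exp_add]; ring_nf

lemma integrable_exp_neg_abs (c : ℝ) (hc : 0 < c) :
    Integrable (fun t : ℝ => Real.exp (-(c*|t|))) := by
  have h1 : IntegrableOn (fun t : ℝ => Real.exp (-(c*|t|))) (Set.Ioi 0) := by
    refine (integrableOn_exp_mul_Ioi (a := -c) (by linarith) 0).congr_fun ?_ measurableSet_Ioi
    intro t ht
    simp only [abs_of_pos (Set.mem_Ioi.1 ht)]; ring_nf
  have h2 : IntegrableOn (fun t : ℝ => Real.exp (-(c*|t|))) (Set.Iic 0) := by
    refine (integrableOn_exp_mul_Iic (a := c) hc 0).congr_fun ?_ measurableSet_Iic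
    intro t ht
    simp only [abs_of_nonpos (Set.mem_Iic.1 ht)]; ring_nf
  have := h2.union h1
  rwa [Set.Iic_union_Ioi, integrableOn_univ] at this

lemma Fk_cont (k : ℤ) (ε : ℝ) (hε : ε ∈ Set.Ioo (0:ℝ) Real.pi) (z : ℂ) :
    Continuous (Fk k ε z) := by
  unfold Fk
  refine Continuous.div₀ ?_ (by fun_prop) (fun t => sinh_ne t ε (sin_pos_of ε hε))
  refine Continuous.mul (by fun_prop) ?_
  exact Continuous.zpow₀ (by fun_prop) k (fun t => Or.inl (tI_ne t ε hε.1))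

lemma Fk_int (k : ℤ) (ε : ℝ) (hε : ε ∈ Set.Ioo (0:ℝ) Real.pi) (z : ℂ) (hz : |z.im| < 1/2) :
    Integrable (Fk k ε z) := by
  obtain ⟨C, c, hC, hc, h⟩ := Fk_bound k ε hε _ hz
  exact ((integrable_exp_neg_abs c hc).const_mul _).mono' (Fk_cont k ε hε z).aestronglyMeasurable
    (Filter.Eventually.of_forall (h z le_rfl))

/-- integral -/
noncomputable def Gk (k : ℤ) (ε : ℝ) (z : ℂ) : ℂ := ∫ t : ℝ, Fk k ε z t

lemma Gk_decay (k : ℤ) (ε : ℝ) (hε : ε ∈ Set.Ioo (0:ℝ) Real.pi) (β : ℝ) (hβ : β < 1/2) :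
    ∃ C : ℝ, ∀ z : ℂ, |z.im| ≤ β → ‖Gk k ε z‖ ≤ C * Real.exp (2*ε*z.re) := by
  obtain ⟨C, c, hC, hc, h⟩ := Fk_bound k ε hε _ hβ
  refine ⟨C * ∫ t : ℝ, Real.exp (-(c*|t|)), fun z hz => ?_⟩
  refine (norm_integral_le_of_norm_le ((integrable_exp_neg_abs c hc).const_mul _)
    (Filter.Eventually.of_forall (h z hz))).trans ?_
  rw [integral_const_mul]
  apply le_of_eq; ring

lemma Gk_deriv (k : ℤ) (ε : ℝ) (hε : ε ∈ Set.Ioo (0:ℝ) Real.pi) (z : ℂ) (hz : |z.im| < 1/2) :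
    HasDerivAt (Gk k ε) (-2*Complex.I * Gk (k+1) ε z) z := by
  obtain ⟨β, hβ1, hβ2⟩ := exists_between hz
  obtain ⟨C, c, hC, hc, h⟩ := Fk_bound (k+1) ε hε _ hβ2
  have hs : {w : ℂ | |w.im| < β ∧ w.re < z.re + 1} ∈ nhds z := by
    apply IsOpen.mem_nhds
    · have o1 : IsOpen {w : ℂ | |w.im| < β} := isOpen_lt (by fun_prop) (by fun_prop)
      have o2 : IsOpen {w : ℂ | w.re < z.re + 1} := isOpen_lt (by fun_prop) (by fun_prop)
      exact o1.inter o2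
    · exact ⟨hβ1, by linarith⟩
  have key := hasDerivAt_integral_of_dominated_loc_of_deriv_le (μ := volume) (F := fun z t => Fk k ε z t)
    (F' := fun z t => -2*Complex.I * Fk (k+1) ε z t)
    (bound := fun t => 2 * (C * Real.exp (2*ε*(z.re+1)) * Real.exp (-(c*|t|)))) hs
    (Filter.Eventually.of_forall fun w => (Fk_cont k ε hε w).aestronglyMeasurable)
    (Fk_int k ε hε z hz)
    ((Fk_int (k+1) ε hε z hz).const_mul _).aestronglyMeasurable
    (Filter.Eventually.of_forall fun t w hw => ?_)
    (((integrable_exp_neg_abs c hc).const_mul _).const_mul _)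
    (Filter.Eventually.of_forall fun t w hw => ?_)
  · have := key.2
    rw [integral_const_mul] at this
    exact this
  · rw [norm_mul]
    have h0 := h w hw.1.le t
    have he := hε.1
    have h1 : Real.exp (2*ε*w.re) ≤ Real.exp (2*ε*(z.re+1)) :=
      Real.exp_le_exp.2 (by nlinarith [hw.2])
    have : ‖(-2*Complex.I : ℂ)‖ = 2 := by simp
    rw [this]
    gcongr
    exact h0.trans (by gcongr)
  · unfold Fk
    have hx := tI_ne t ε hε.1
    rw [zpow_add_one₀ hx]
    have h1 : HasDerivAt (fun w : ℂ => Complex.exp (-(2*Complex.I*((t:ℂ)+Complex.I*(ε:ℂ))*w)))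
        (Complex.exp (-(2*Complex.I*((t:ℂ)+Complex.I*(ε:ℂ))*w)) * (-(2*Complex.I*((t:ℂ)+Complex.I*(ε:ℂ))*1))) w :=
      (((hasDerivAt_id w).const_mul _).neg).cexp
    refine ((h1.mul_const (((t:ℂ)+Complex.I*(ε:ℂ)) ^ k)).div_const
      (Complex.sinh ((t:ℂ)+Complex.I*(ε:ℂ)))).congr_deriv ?_
    ring

lemma G0_shift (a b : ℝ) (ha : a ∈ Set.Ioo (0:ℝ) Real.pi) (hb : b ∈ Set.Ioo (0:ℝ) Real.pi)
    (z : ℂ) (hz : |z.im| < 1/2) : Gk 0 a z = Gk 0 b z := by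
  set f : ℂ → ℂ := fun x => Complex.exp (-(2*Complex.I*x*z)) / Complex.sinh x with hf
  have hfF : ∀ y t : ℝ, f (t + y * Complex.I) = Fk 0 y z t := by
    intro y t; simp [hf, Fk, mul_comm Complex.I (y:ℂ)]
  have hsub : ∀ y ∈ Set.uIcc a b, y ∈ Set.Ioo (0:ℝ) Real.pi := fun y hy =>
    Set.ordConnected_Ioo.uIcc_subset ha hb hy
  have hdiff : ∀ T : ℝ, DifferentiableOn ℂ f (Set.uIcc (-T) T ×ℂ Set.uIcc a b) := by
    intro T x hx
    have hy := hsub x.im hx.2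
    have : x = (x.re : ℂ) + Complex.I * (x.im : ℂ) := by
      rw [mul_comm]; exact (Complex.re_add_im x).symm
    have hne : Complex.sinh x ≠ 0 := by
      rw [this]; exact sinh_ne _ _ (sin_pos_of _ hy)
    apply DifferentiableAt.differentiableWithinAt
    simp only [hf]
    exact DifferentiableAt.div (by fun_prop) (by fun_prop) hne
  have hrect : ∀ T : ℝ, (∫ t : ℝ in (-T)..T, Fk 0 a z t) - (∫ t : ℝ in (-T)..T, Fk 0 b z t) +
      Complex.I * (∫ y : ℝ in a..b, Fk 0 y z T) - Complex.I * (∫ y : ℝ in a..b, Fk 0 y z (-T)) = 0 := by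
    intro T
    have := Complex.integral_boundary_rect_eq_zero_of_differentiableOn f ⟨-T, a⟩ ⟨T, b⟩ (hdiff T)
    simp only [hfF, smul_eq_mul] at this
    exact this
  -- uniform bound
  obtain ⟨m, hm, hmb⟩ : ∃ m : ℝ, 0 < m ∧ ∀ y ∈ Set.uIcc a b, m ≤ Real.sin y := by
    obtain ⟨y0, hy0, h⟩ := isCompact_uIcc.exists_isMinOn (Set.nonempty_uIcc (a := a) (b := b))
      (Real.continuous_sin.continuousOn)
    exact ⟨Real.sin y0, sin_pos_of _ (hsub _ hy0), fun y hy => h hy⟩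
  set c := 1 - 2 * |z.im| with hc
  have hcpos : 0 < c := by linarith
  have hbd : ∀ t : ℝ, ∀ y ∈ Set.uIcc a b, ‖Fk 0 y z t‖ ≤
      Real.exp (2*Real.pi*|z.re|) * (2 / m * Real.exp (-(c*|t|))) := by
    intro t y hy
    have h1 := hsub y hy
    have h2 := norm_Fk_le 0 y (sin_pos_of _ h1) z t |z.im| le_rfl
    rw [zpow_zero, one_mul] at h2
    refine h2.trans ?_
    have h3 : 2*y*z.re ≤ 2*Real.pi*|z.re| := by
      have : y * z.re ≤ Real.pi * |z.re| := by
        calc y * z.re ≤ y * |z.re| := by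
              have := h1.1; gcongr; exact le_abs_self _
          _ ≤ _ := by have := h1.2; gcongr
      linarith
    have h4 := hmb y hy
    have h5 := sin_pos_of _ h1
    gcongr
  have hside : ∀ s : ℝ, |s| = 1 → Filter.Tendsto (fun T : ℝ => ∫ y : ℝ in a..b, Fk 0 y z (s*T)) Filter.atTop (nhds 0) := by
    intro s hs
    have hlim : Filter.Tendsto (fun T : ℝ => Real.exp (2*Real.pi*|z.re|) * (2 / m * Real.exp (-(c*T))) * |b - a|)
        Filter.atTop (nhds 0) := by
      have : Filter.Tendsto (fun T : ℝ => Real.exp (-(c*T))) Filter.atTop (nhds 0) :=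
        Real.tendsto_exp_neg_atTop_nhds_zero.comp (Filter.tendsto_id.const_mul_atTop hcpos)
      simpa using ((this.const_mul (2/m)).const_mul (Real.exp (2*Real.pi*|z.re|))).mul_const |b-a|
    refine squeeze_zero_norm' ?_ hlim
    filter_upwards [Filter.eventually_ge_atTop 0] with T hT
    refine intervalIntegral.norm_integral_le_of_norm_le_const fun y hy => ?_
    have := hbd (s*T) y (Set.uIoc_subset_uIcc hy)
    rwa [abs_mul, hs, one_mul, abs_of_nonneg hT] at this
  have hA := intervalIntegral_tendsto_integral (Fk_int 0 a ha z hz) Filter.tendsto_neg_atTop_atBot Filter.tendsto_id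
  have hB := intervalIntegral_tendsto_integral (Fk_int 0 b hb z hz) Filter.tendsto_neg_atTop_atBot Filter.tendsto_id
  have h1 := hside 1 (by simp)
  have h2 := hside (-1) (by simp)
  have hall := ((hA.sub hB).add (h1.const_mul Complex.I)).sub (h2.const_mul Complex.I)
  have hz0 : Filter.Tendsto (fun _ : ℝ => (0:ℂ)) Filter.atTop (nhds 0) := tendsto_const_nhds
  have := tendsto_nhds_unique (hall.congr (fun T => ?_)) hz0
  · simp only [mul_zero, add_zero, sub_zero] at this
    exact sub_eq_zero.1 this
  · simpa using hrect T

lemma beta_eval (z : ℂ) (hz : |z.im| < 1/2) :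
    ∫ t : ℝ, Complex.exp (-(2*Complex.I*t*z)) / Complex.cosh t = Real.pi / Complex.cosh (Real.pi * z) := by
  have hz' := abs_lt.1 hz
  set u : ℂ := 1/2 - Complex.I * z with hu
  set v : ℂ := 1/2 + Complex.I * z with hv
  have huv : u + v = 1 := by rw [hu, hv]; ring
  have hure : 0 < u.re := by simp [hu]; linarith
  have hvre : 0 < v.re := by simp [hv]; linarith
  have h1 := Complex.Gamma_mul_Gamma_eq_betaIntegral hure hvre
  rw [huv, Complex.Gamma_one, one_mul, show v = 1 - u by rw [← huv]; ring,
    Complex.Gamma_mul_Gamma_one_sub] at h1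
  have h2 : Complex.sin (Real.pi * u) = Complex.cosh (Real.pi * z) := by
    rw [← Complex.cos_mul_I, hu, ← Complex.cos_pi_div_two_sub]
    congr 1; ring
  rw [h2, show 1 - u = v by rw [← huv]; ring] at h1
  rw [h1, Complex.betaIntegral, intervalIntegral.integral_of_le zero_le_one,
    integral_Ioc_eq_integral_Ioo, ← Real.range_sigmoid, ← Set.image_univ,
    integral_image_eq_integral_abs_deriv_smul MeasurableSet.univ
      (fun x _ => (Real.hasDerivAt_sigmoid x).hasDerivWithinAt) Real.sigmoid_injective.injOn]
  rw [setIntegral_univ]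
  have h3 : ∀ s : ℝ, |Real.sigmoid s * (1 - Real.sigmoid s)| • (((Real.sigmoid s : ℝ) : ℂ) ^ (u - 1) *
      (1 - ((Real.sigmoid s : ℝ) : ℂ)) ^ (v - 1)) =
      (fun t : ℝ => (1/2 : ℂ) * (Complex.exp (-(2*Complex.I*t*z)) / Complex.cosh t)) (2⁻¹ * s) := by
    intro s
    have hp := Real.sigmoid_pos s
    have hq : 0 < 1 - Real.sigmoid s := by linarith [Real.sigmoid_lt_one s]
    have hpc : ((Real.sigmoid s : ℝ) : ℂ) ≠ 0 := by exact_mod_cast hp.ne'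
    have hqc : ((1 - Real.sigmoid s : ℝ) : ℂ) ≠ 0 := by exact_mod_cast hq.ne'
    set L := Real.log (2 * Real.cosh (s/2)) with hL
    have hcp : 0 < 2 * Real.cosh (s/2) := by have := Real.cosh_pos (s/2); positivity
    have hexpL : Real.exp L = 2 * Real.cosh (s/2) := Real.exp_log hcp
    have hs1 : Real.sigmoid s = Real.exp (s/2 - L) := by
      rw [Real.exp_sub, hexpL, Real.sigmoid_def, Real.cosh_eq, eq_div_iff (by positivity),
        inv_mul_eq_iff_eq_mul₀ (by positivity), add_mul, ← Real.exp_add, one_mul]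
      ring_nf
    have hs2 : 1 - Real.sigmoid s = Real.exp (-(s/2) - L) := by
      rw [← Real.sigmoid_neg, Real.exp_sub, hexpL, Real.sigmoid_def, Real.cosh_eq, eq_div_iff (by positivity),
        inv_mul_eq_iff_eq_mul₀ (by positivity), add_mul, ← Real.exp_add, one_mul]
      ring_nf
    rw [abs_of_pos (mul_pos hp hq), Complex.real_smul]
    have e1 : (((Real.sigmoid s * (1 - Real.sigmoid s) : ℝ)) : ℂ) * (((Real.sigmoid s : ℝ) : ℂ) ^ (u - 1) *
      (1 - ((Real.sigmoid s : ℝ) : ℂ)) ^ (v - 1)) = ((Real.sigmoid s : ℝ) : ℂ) ^ u * ((1 - Real.sigmoid s : ℝ) : ℂ) ^ v := by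
      rw [Complex.cpow_sub _ _ hpc, Complex.cpow_one]
      rw [show (1 - ((Real.sigmoid s : ℝ) : ℂ)) = ((1 - Real.sigmoid s : ℝ) : ℂ) by push_cast; rfl]
      rw [Complex.cpow_sub _ _ hqc, Complex.cpow_one, Complex.ofReal_mul]
      field_simp
    rw [e1, hs2, hs1, Complex.cpow_def_of_ne_zero (by exact_mod_cast (Real.exp_pos _).ne'),
      Complex.cpow_def_of_ne_zero (by exact_mod_cast (Real.exp_pos _).ne'),
      ← Complex.ofReal_log (Real.exp_pos _).le, ← Complex.ofReal_log (Real.exp_pos _).le,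
      Real.log_exp, Real.log_exp, ← Complex.exp_add]
    have e2 : ((s/2 - L : ℝ) : ℂ) * u + ((-(s/2) - L : ℝ) : ℂ) * v = -(2*Complex.I*((2⁻¹ * s : ℝ):ℂ)*z) - (L : ℂ) := by
      rw [hu, hv]; push_cast; ring
    rw [e2, Complex.exp_sub, ← Complex.ofReal_exp, hexpL]
    have e3 : ((2 * Real.cosh (s/2) : ℝ) : ℂ) = 2 * Complex.cosh ((2⁻¹ * s : ℝ):ℂ) := by
      push_cast; congr 2; ring
    rw [e3]
    simp only []
    field_simp
  rw [integral_congr_ae (Filter.Eventually.of_forall h3)]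
  rw [Measure.integral_comp_mul_left
    (fun t : ℝ => (1/2 : ℂ) * (Complex.exp (-(2*Complex.I*t*z)) / Complex.cosh t))]
  rw [integral_const_mul, Complex.real_smul]
  simp
  
lemma G0_eval (ε : ℝ) (hε : ε ∈ Set.Ioo (0:ℝ) Real.pi) (z : ℂ) (hz : |z.im| < 1/2) :
    Gk 0 ε z = 2 * (Real.pi * Complex.I) * (-Complex.exp (2*Real.pi*z) / (1 + Complex.exp (2*Real.pi*z))) := by
  rw [G0_shift ε (Real.pi/2) hε ⟨by positivity, by linarith [Real.pi_pos]⟩ z hz]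
  have h : ∀ t : ℝ, Fk 0 (Real.pi/2) z t = (Complex.exp (Real.pi * z) / Complex.I) *
      (Complex.exp (-(2*Complex.I*t*z)) / Complex.cosh t) := by
    intro t
    have hs : Complex.sinh ((t:ℂ) + Complex.I * ((Real.pi/2 : ℝ) : ℂ)) = Complex.I * Complex.cosh t := by
      rw [mul_comm Complex.I, Complex.sinh_add, Complex.cosh_mul_I, Complex.sinh_mul_I]
      push_cast
      rw [Complex.cos_pi_div_two, Complex.sin_pi_div_two]; ring
    have he : Complex.exp (-(2*Complex.I*((t:ℂ)+Complex.I*((Real.pi/2:ℝ):ℂ))*z)) =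
        Complex.exp (Real.pi * z) * Complex.exp (-(2*Complex.I*t*z)) := by
      rw [← Complex.exp_add]
      congr 1
      push_cast
      linear_combination (-(Real.pi:ℂ) * z) * Complex.I_sq
    unfold Fk
    rw [hs, he, zpow_zero, mul_one, mul_div_mul_comm]
  unfold Gk
  simp_rw [h]
  rw [integral_const_mul, beta_eval z hz, Complex.cosh]
  have e1 : Complex.exp (2*Real.pi*z) = Complex.exp (Real.pi*z) * Complex.exp (Real.pi*z) := by
    rw [← Complex.exp_add]; congr 1; ring
  have e2 : Complex.exp (-(Real.pi*z)) = (Complex.exp (Real.pi*z))⁻¹ := Complex.exp_neg _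
  have e0 := Complex.exp_ne_zero (Real.pi * z)
  rw [e1, e2]
  set E := Complex.exp (Real.pi * z)
  have e3 : (E + E⁻¹) / 2 = (1 + E * E) / (2 * E) := by field_simp; ring
  rw [e3, div_div_eq_mul_div, div_eq_mul_inv E Complex.I, Complex.inv_I]
  ring

lemma exp_slit (w : ℂ) (hw : |w.im| < Real.pi) : Complex.exp w ∈ Complex.slitPlane := by
  rw [Complex.mem_slitPlane_iff_arg]
  refine ⟨?_, Complex.exp_ne_zero _⟩
  have h := abs_lt.1 hw
  have : Complex.arg (Complex.exp w) = w.im := by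
    rw [← Complex.log_im, Complex.log_exp h.1 h.2.le]
  rw [this]
  exact h.2.ne

lemma slit_one_add (e : ℂ) (he : e ∈ Complex.slitPlane) (s : ℝ) (hs : 0 ≤ s) :
    1 + (s:ℂ) * e ∈ Complex.slitPlane := by
  rcases hs.eq_or_lt with rfl | hs
  · simp
  rw [Complex.mem_slitPlane_iff] at he ⊢
  rcases he with he | he
  · left
    simp; positivity
  · right
    simp [hs.ne', he]

lemma im_2pi (z : ℂ) (hz : |z.im| < 1/2) : |((2*Real.pi*z : ℂ)).im| < Real.pi := by
  have : ((2*Real.pi*z : ℂ)).im = 2*Real.pi*z.im := by simp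
  rw [this, abs_mul, abs_of_pos (by positivity)]
  have := Real.pi_pos
  nlinarith

lemma one_add_exp_slit (z : ℂ) (hz : |z.im| < 1/2) :
    1 + Complex.exp (2*Real.pi*z) ∈ Complex.slitPlane := by
  have := slit_one_add _ (exp_slit _ (im_2pi z hz)) 1 zero_le_one
  simpa using this

lemma exp_deriv (z : ℂ) : HasDerivAt (fun z : ℂ => Complex.exp (2*Real.pi*z))
    (Complex.exp (2*Real.pi*z) * (2*Real.pi)) z := by
  have := ((hasDerivAt_id z).const_mul (2*Real.pi : ℂ)).cexp
  simpa using this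

lemma LiNeg_an (m : ℕ) : AnalyticOnNhd ℂ (LiNeg m) {1}ᶜ := by
  induction m with
  | zero =>
    intro w hw
    have : (1:ℂ) - w ≠ 0 := sub_ne_zero.2 (Ne.symm hw)
    exact AnalyticAt.div analyticAt_id (analyticAt_const.sub analyticAt_id) this
  | succ m ih =>
    intro w hw
    exact analyticAt_id.mul (ih.deriv w hw)

lemma Gm_eval (ε : ℝ) (hε : ε ∈ Set.Ioo (0:ℝ) Real.pi) (m : ℕ) : ∀ (z : ℂ), |z.im| < 1/2 →
    Gk m ε z = 2 * LiNeg m (-Complex.exp (2*Real.pi*z)) * (Real.pi * Complex.I)^(m+1) := by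
  induction m with
  | zero =>
    intro z hz
    have := G0_eval ε hε z hz
    simp only [LiNeg, Nat.cast_zero]
    rw [this, sub_neg_eq_add]; ring
  | succ m ih =>
    intro z hz
    have h1 := Gk_deriv m ε hε z hz
    have hw : -Complex.exp (2*Real.pi*z) ≠ 1 := by
      intro h
      apply Complex.slitPlane_ne_zero (one_add_exp_slit z hz)
      linear_combination -h
    have h2 := ((LiNeg_an m _ hw).differentiableAt).hasDerivAt
    have h3 : HasDerivAt (fun z : ℂ => LiNeg m (-Complex.exp (2*Real.pi*z)))
      (deriv (LiNeg m) (-Complex.exp (2*Real.pi*z)) * -(Complex.exp (2*Real.pi*z) * (2*Real.pi))) z :=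
      HasDerivAt.comp z h2 (exp_deriv z).neg
    have h4 := (h3.const_mul 2).mul_const ((Real.pi * Complex.I : ℂ)^(m+1))
    have o1 : IsOpen {w : ℂ | |w.im| < 1/2} := isOpen_lt (by fun_prop) (by fun_prop)
    have h5 := h4.congr_of_eventuallyEq (f₁ := Gk m ε) (by
      filter_upwards [o1.mem_nhds hz] with w hw
      exact ih w hw)
    have h6 := h1.unique h5
    push_cast
    simp only [LiNeg]
    have hI := Complex.I_mul_I
    have : Gk (m+1) ε z = Complex.I / 2 * (-2 * Complex.I * Gk (m+1) ε z) := by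
      linear_combination (Gk (m+1) ε z) * hI
    rw [this, h6]
    ring

lemma zero_of_deriv (h : ℝ → ℂ) (hd : ∀ a, HasDerivAt h 0 a) (hl : Filter.Tendsto h Filter.atBot (nhds 0))
    (a : ℝ) : h a = 0 := by
  have hc : h = fun _ => h a := by
    ext b
    exact is_const_of_deriv_eq_zero (fun x => (hd x).differentiableAt) (fun x => (hd x).deriv) b a
  rw [hc] at hl
  exact tendsto_nhds_unique tendsto_const_nhds hl

/-- horizontal line -/
noncomputable def lin (b : ℝ) (a : ℝ) : ℂ := (a:ℂ) + b * Complex.I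

lemma lin_im (b a : ℝ) : (lin b a).im = b := by simp [lin]
lemma lin_re (b a : ℝ) : (lin b a).re = a := by simp [lin]

lemma lin_deriv (b a : ℝ) : HasDerivAt (lin b) 1 a :=
  (Complex.ofRealCLM.hasDerivAt (x := a)).add_const (b * Complex.I)

lemma comp_lin {f : ℂ → ℂ} {f' : ℂ} (b a : ℝ) (h : HasDerivAt f f' (lin b a)) :
    HasDerivAt (fun a => f (lin b a)) f' a := by
  have := HasDerivAt.comp a h (lin_deriv b a)
  rw [mul_one] at this
  exact this

lemma Gk_lin_tendsto (k : ℤ) (ε : ℝ) (hε : ε ∈ Set.Ioo (0:ℝ) Real.pi) (b : ℝ) (hb : |b| < 1/2) :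
    Filter.Tendsto (fun a => Gk k ε (lin b a)) Filter.atBot (nhds 0) := by
  obtain ⟨C, hC⟩ := Gk_decay k ε hε |b| hb
  have hlim : Filter.Tendsto (fun a : ℝ => C * Real.exp (2*ε*a)) Filter.atBot (nhds 0) := by
    have h1 : Filter.Tendsto (fun a : ℝ => 2*ε*a) Filter.atBot Filter.atBot :=
      Filter.tendsto_id.const_mul_atBot (by have := hε.1; positivity)
    simpa using (Real.tendsto_exp_atBot.comp h1).const_mul C
  refine squeeze_zero_norm (fun a => ?_) hlim
  have := hC (lin b a) (by rw [lin_im])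
  rwa [lin_re] at this

lemma exp_lin (b a : ℝ) : Complex.exp (2*Real.pi*lin b a) =
    ((Real.exp (2*Real.pi*a) : ℝ) : ℂ) * Complex.exp (2*Real.pi*(b*Complex.I)) := by
  rw [Complex.ofReal_exp, ← Complex.exp_add]
  congr 1
  simp [lin]; ring

lemma rexp_tendsto : Filter.Tendsto (fun a : ℝ => Real.exp (2*Real.pi*a)) Filter.atBot (nhds 0) :=
  Real.tendsto_exp_atBot.comp (Filter.tendsto_id.const_mul_atBot (by positivity))

lemma Gneg1 (ε : ℝ) (hε : ε ∈ Set.Ioo (0:ℝ) Real.pi) (b : ℝ) (hb : |b| < 1/2) (a : ℝ) :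
    Gk (-1) ε (lin b a) = -2 * Complex.log (1 + Complex.exp (2*Real.pi*lin b a)) := by
  have hz : ∀ a, |(lin b a).im| < 1/2 := fun a => by rwa [lin_im]
  have := zero_of_deriv (fun a => Gk (-1) ε (lin b a) + 2 * Complex.log (1 + Complex.exp (2*Real.pi*lin b a)))
    ?_ ?_ a
  · linear_combination this
  · intro a
    have h1 := Gk_deriv (-1) ε hε _ (hz a)
    have hs := one_add_exp_slit _ (hz a)
    have h2 := (((exp_deriv (lin b a)).const_add 1).clog hs).const_mul 2
    have h3 := comp_lin b a (h1.add h2)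
    refine h3.congr_deriv ?_
    rw [show (-1 + 1 : ℤ) = 0 by norm_num, G0_eval ε hε _ (hz a)]
    have hne := Complex.slitPlane_ne_zero hs
    have hI := Complex.I_mul_I
    linear_combination (4 * Real.pi * Complex.exp (2*Real.pi*lin b a) / (1 + Complex.exp (2*Real.pi*lin b a))) * hI
  · have h1 := Gk_lin_tendsto (-1) ε hε b hb
    have h2 : Filter.Tendsto (fun a => 2 * Complex.log (1 + Complex.exp (2*Real.pi*lin b a))) Filter.atBot (nhds 0) := by
      have e : Filter.Tendsto (fun a => 1 + Complex.exp (2*Real.pi*lin b a)) Filter.atBot (nhds 1) := by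
        simp_rw [exp_lin]
        have := (((Complex.continuous_ofReal.tendsto 0).comp rexp_tendsto).mul_const
          (Complex.exp (2*Real.pi*(b*Complex.I)))).const_add 1
        simpa using this
      have := (e.clog Complex.one_mem_slitPlane).const_mul 2
      simpa using this
    simpa using h1.add h2

lemma Li2_ray (e : ℂ) (he : e ∈ Complex.slitPlane) : ∃ P : ℝ → ℂ, P 0 = 0 ∧
    (∀ r : ℝ, 0 < r → Li2 (-(r * e)) = P r) ∧
    ∃ ψ : ℝ → ℂ, (∀ r : ℝ, 0 ≤ r → HasDerivAt P (ψ r) r) ∧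
      ∀ r : ℝ, 0 < r → ψ r * r = -Complex.log (1 + r * e) := by
  set g : ℝ → ℂ := fun s => Complex.log (1 + s * e) with hg
  set ψ : ℝ → ℂ := dslope g 0 with hψ
  set U : Set ℝ := {s : ℝ | 1 + (s:ℂ) * e ∈ Complex.slitPlane} with hU
  have hUo : IsOpen U := Complex.isOpen_slitPlane.preimage (by fun_prop)
  have hUm : ∀ s : ℝ, 0 ≤ s → s ∈ U := fun s hs => slit_one_add e he s hs
  have hgd : ∀ s ∈ U, DifferentiableAt ℝ g s := by
    intro s hs
    have h1 : HasDerivAt (fun s : ℝ => 1 + (s:ℂ) * e) (1 * e) s :=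
      ((Complex.ofRealCLM.hasDerivAt (x := s)).mul_const e).const_add 1
    exact (h1.clog_real hs).differentiableAt
  have hψc : ∀ s ∈ U, ContinuousAt ψ s := by
    intro s hs
    by_cases h0 : s = 0
    · subst h0
      exact continuousAt_dslope_same.2 (hgd 0 hs)
    · exact (continuousAt_dslope_of_ne h0).2 (hgd s hs).continuousAt
  have hψv : ∀ s : ℝ, s ≠ 0 → ψ s * s = g s := by
    intro s hs
    have hs' : (s:ℂ) ≠ 0 := by exact_mod_cast hs
    rw [hψ, dslope_of_ne _ hs, slope_def_module, Complex.real_smul]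
    simp [hg]
    field_simp
  refine ⟨fun r => -∫ s in (0:ℝ)..r, ψ s, by simp, ?_, fun r => -ψ r, ?_, ?_⟩
  · intro r hr
    unfold Li2
    have h1 := intervalIntegral.smul_integral_comp_mul_left (a := 0) (b := 1) ψ r
    rw [mul_zero, mul_one] at h1
    simp only []
    rw [← h1, ← intervalIntegral.integral_smul]
    congr 1
    apply intervalIntegral.integral_congr_ae
    filter_upwards with t ht
    rw [Set.uIoc_of_le zero_le_one] at ht
    have ht' : (t:ℂ) ≠ 0 := by exact_mod_cast ht.1.ne'
    have h2 := hψv (r*t) (mul_ne_zero hr.ne' ht.1.ne')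
    rw [div_eq_iff ht', Complex.real_smul]
    have h3 : Complex.log (1 - (t:ℂ) * -(r * e)) = g (r*t) := by
      simp only [hg]; congr 1; push_cast; ring
    rw [h3, ← h2]
    push_cast; ring
  · intro r hr
    have hint : IntervalIntegrable ψ volume 0 r := by
      apply ContinuousOn.intervalIntegrable
      intro s hs
      rw [Set.uIcc_of_le hr] at hs
      exact (hψc s (hUm s hs.1)).continuousWithinAt
    have hm : StronglyMeasurableAtFilter ψ (nhds r) volume :=
      ContinuousOn.stronglyMeasurableAtFilter hUo (fun s hs => (hψc s hs).continuousWithinAt) r (hUm r hr)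
    exact (intervalIntegral.integral_hasDerivAt_right hint hm (hψc r (hUm r hr))).neg
  · intro r hr
    have := hψv r hr.ne'
    simp only [hg] at this
    rw [neg_mul, this]

lemma Gneg2 (ε : ℝ) (hε : ε ∈ Set.Ioo (0:ℝ) Real.pi) (b : ℝ) (hb : |b| < 1/2) (a : ℝ) :
    Gk (-2) ε (lin b a) = 2 * Li2 (-Complex.exp (2*Real.pi*lin b a)) / (Real.pi * Complex.I) := by
  have hz : ∀ a, |(lin b a).im| < 1/2 := fun a => by rwa [lin_im]
  have he : Complex.exp (2*Real.pi*(b*Complex.I)) ∈ Complex.slitPlane := by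
    apply exp_slit
    apply im_2pi
    simpa using hb
  obtain ⟨P, hP0, hP, ψ, hψ, hψv⟩ := Li2_ray _ he
  have hpi : (Real.pi : ℂ) ≠ 0 := by exact_mod_cast Real.pi_ne_zero
  have := zero_of_deriv (fun a => Gk (-2) ε (lin b a) - 2 / (Real.pi * Complex.I) * P (Real.exp (2*Real.pi*a)))
    ?_ ?_ a
  · rw [exp_lin, hP _ (Real.exp_pos _)]
    linear_combination this
  · intro a
    have h1 := comp_lin b a (Gk_deriv (-2) ε hε _ (hz a))
    have h2 : HasDerivAt (fun a : ℝ => Real.exp (2*Real.pi*a)) (Real.exp (2*Real.pi*a) * (2*Real.pi)) a := by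
      have := ((hasDerivAt_id a).const_mul (2*Real.pi)).exp
      simpa using this
    have h3 := HasDerivAt.scomp a (hψ _ (Real.exp_pos (2*Real.pi*a)).le) h2
    have h4 := h1.sub (h3.const_mul (2 / (Real.pi * Complex.I) : ℂ))
    refine h4.congr_deriv ?_
    have h5 := hψv _ (Real.exp_pos (2*Real.pi*a))
    rw [← exp_lin] at h5
    rw [show (-2 + 1 : ℤ) = -1 by norm_num, Gneg1 ε hε b hb a, Complex.real_smul]
    have h6 : Complex.log (1 + Complex.exp (2*Real.pi*lin b a)) = - (ψ (Real.exp (2*Real.pi*a)) * ((Real.exp (2*Real.pi*a) : ℝ) : ℂ)) := by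
      rw [h5]; ring
    rw [h6, Complex.ofReal_mul]
    push_cast
    have hI := Complex.I_sq
    field_simp
    rw [hI]; ring
  · have h1 := Gk_lin_tendsto (-2) ε hε b hb
    have h2 := ((hψ 0 le_rfl).continuousAt.tendsto.comp rexp_tendsto).const_mul (2 / (Real.pi * Complex.I) : ℂ)
    have := h1.sub h2
    simpa [hP0] using this

/-- the contour integral identity
`∫_{ℝ+iε} e^{-2ixz} x^{2n-2}/sinh(x) dx = 2 Li_{2-2n}(-e^{2πz}) (πi)^{2n-1}`. -/
theorem sinh_integral_eq_polylog (n : ℕ) (z : ℂ) (hz : |z.im| < 1/2)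
    (ε : ℝ) (hε : ε ∈ Set.Ioo (0:ℝ) Real.pi) :
    ∫ t : ℝ, Complex.exp (-(2*Complex.I*((t:ℂ)+Complex.I*(ε:ℂ))*z)) *
        ((t:ℂ)+Complex.I*(ε:ℂ)) ^ (2*(n:ℤ)-2) / Complex.sinh ((t:ℂ)+Complex.I*(ε:ℂ))
      = 2 * LiIdx n (-Complex.exp (2*(Real.pi:ℂ)*z)) * ((Real.pi:ℂ)*Complex.I) ^ (2*(n:ℤ)-1) := by
  change Gk (2*(n:ℤ)-2) ε z = _
  rcases n with _ | n
  · have h := Gneg2 ε hε z.im hz z.re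
    have hl : lin z.im z.re = z := Complex.re_add_im z
    rw [hl] at h
    simp only [LiIdx, if_true, Nat.cast_zero, mul_zero, zero_sub]
    rw [h, zpow_neg_one, div_eq_mul_inv]
  · have h := Gm_eval ε hε (2*n) z hz
    have e1 : 2*((n+1 : ℕ):ℤ)-2 = ((2*n : ℕ) : ℤ) := by push_cast; ring
    have e2 : 2*((n+1 : ℕ):ℤ)-1 = ((2*n+1 : ℕ) : ℤ) := by push_cast; ring
    rw [e1, e2, h, zpow_natCast]
    simp only [LiIdx, if_neg (Nat.succ_ne_zero n)]
    rw [show 2*(n+1) - 2 = 2*n by omega]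
end

section
/- For every integer N ≥ 1 and every δ ∈ (0, 1/2) there exist constants C > 0 and b₀ ∈ (0,1) such that for all b ∈ (0, b₀) and all z ∈ ℂ with |Im z| ≤ 1/2 − δ: |L_b(z/b) − πi z²/(2b²) − πi(b² + b⁻²)/24 + Σ_{n=0}^{N} ((1 − 2^{2n−1}) B_{2n}/(2n)!) · Li_{2−2n}(−e^{2πz}) · (πi b²)^{2n−1}| ≤ C·b^{4N+2}. (Here L_b(z/b) = ln s_b(z/b) for the hyperbolic gamma function s_b = exp L_b.) -/
open MeasureTheory

section Helpers
open MeasureTheory Set Filter Topology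

lemma x_div_sinh_le {x : ℝ} (hx : 0 < x) : x / Real.sinh x ≤ (1 + 2 * x) * Real.exp (-x) := by
  have h1 : 0 < Real.sinh x := Real.sinh_pos_iff.2 hx
  rw [div_le_iff₀ h1, Real.sinh_eq]
  have h2 : Real.exp (-x) * Real.exp (x) = 1 := by rw [← Real.exp_add]; simp
  have h3 : Real.exp (-x) * Real.exp (-x) = Real.exp (-(2*x)) := by rw [← Real.exp_add]; congr 1; ring
  have h4 : (1 + 2 * x) * Real.exp (-(2*x)) ≤ 1 := by
    have := Real.add_one_le_exp (2*x)
    have h5 : Real.exp (2*x) * Real.exp (-(2*x)) = 1 := by rw [← Real.exp_add]; simp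
    nlinarith [Real.exp_pos (-(2*x))]
  nlinarith

lemma integrable_pow_exp (n : ℕ) {c : ℝ} (hc : 0 < c) :
    IntegrableOn (fun x : ℝ => x ^ n * Real.exp (-c * x)) (Ioi 0) := by
  have := integrableOn_rpow_mul_exp_neg_mul_rpow (p := 1) (s := n) (b := c)
    (by have : (0:ℝ) ≤ n := n.cast_nonneg
        linarith) one_pos hc
  simpa using this

lemma kernel_integrable (n : ℕ) {a : ℝ} (ha : a < 1) :
    IntegrableOn (fun x : ℝ => x ^ (n+1) * Real.exp (a * x) / Real.sinh x) (Ioi 0) := by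
  have h1 := (integrable_pow_exp n (sub_pos.2 ha)).add
    ((integrable_pow_exp (n+1) (sub_pos.2 ha)).const_mul 2)
  refine Integrable.mono' h1 ?_ ?_
  · apply Measurable.aestronglyMeasurable
    have := Real.measurable_sinh
    fun_prop
  · refine (ae_restrict_iff' measurableSet_Ioi).2 (ae_of_all _ fun x hx => ?_)
    have hx : 0 < x := hx
    have h1 : 0 < Real.sinh x := Real.sinh_pos_iff.2 hx
    rw [Real.norm_of_nonneg (by positivity)]
    have h2 := x_div_sinh_le hx
    calc x ^ (n+1) * Real.exp (a * x) / Real.sinh x = (x^n * Real.exp (a*x)) * (x / Real.sinh x) := by ring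
      _ ≤ (x^n * Real.exp (a*x)) * ((1 + 2 * x) * Real.exp (-x)) := by gcongr
      _ = _ := by
        have : Real.exp (-(1-a)*x) = Real.exp (a*x) * Real.exp (-x) := by
          rw [← Real.exp_add]; congr 1; ring
        simp only [Pi.add_apply, this]; ring

lemma norm_exp_I_le (w : ℂ) {A : ℝ} (h : |w.im| ≤ A) : ‖Complex.exp (w * Complex.I)‖ ≤ Real.exp A := by
  rw [Complex.norm_exp]; simp; linarith [neg_abs_le w.im]

lemma norm_sin_le_exp (w : ℂ) {A : ℝ} (h : |w.im| ≤ A) : ‖Complex.sin w‖ ≤ Real.exp A := by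
  have h1 := norm_exp_I_le w h
  have h2 := norm_exp_I_le (-w) (A := A) (by simpa using h)
  have h3 : 2 * Complex.sin w = (Complex.exp (-w * Complex.I) - Complex.exp (w * Complex.I)) * Complex.I :=
    Complex.two_sin w
  have h4 := norm_sub_le (Complex.exp (-w * Complex.I)) (Complex.exp (w * Complex.I))
  have h5 : ‖2 * Complex.sin w‖ = ‖(Complex.exp (-w * Complex.I) - Complex.exp (w * Complex.I))‖ := by
    rw [h3]; simp
  simp only [norm_mul, Complex.norm_ofNat] at h5
  linarith

lemma norm_cos_le_exp (w : ℂ) {A : ℝ} (h : |w.im| ≤ A) : ‖Complex.cos w‖ ≤ Real.exp A := by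
  have h1 := norm_exp_I_le w h
  have h2 := norm_exp_I_le (-w) (A := A) (by simpa using h)
  have h3 := Complex.two_cos w
  have h4 := norm_add_le (Complex.exp (w * Complex.I)) (Complex.exp (-w * Complex.I))
  rw [← h3] at h4
  simp only [norm_mul, Complex.norm_ofNat] at h4
  linarith

lemma norm_sin_le_mul (w : ℂ) {A : ℝ} (h : |w.im| ≤ A) : ‖Complex.sin w‖ ≤ ‖w‖ * Real.exp A := by
  have hc : Convex ℝ {v : ℂ | |v.im| ≤ A} := by
    have : {v : ℂ | |v.im| ≤ A} = Complex.imLm ⁻¹' (Icc (-A) A) := by ext v; simp [abs_le]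
    rw [this]; exact (convex_Icc _ _).linear_preimage _
  have := hc.norm_image_sub_le_of_norm_hasDerivWithin_le (f := Complex.sin) (f' := Complex.cos)
    (x := 0) (y := w) (C := Real.exp A) (fun v hv => (Complex.hasDerivAt_sin v).hasDerivWithinAt)
    (fun v hv => norm_cos_le_exp v hv) (by change |(0:ℂ).im| ≤ A; simpa using (abs_nonneg _).trans h) h
  simpa [mul_comm] using this

lemma norm_cos_sub_one_le (w : ℂ) {A : ℝ} (h : |w.im| ≤ A) :
    ‖Complex.cos w - 1‖ ≤ ‖w‖ ^ 2 * Real.exp A := by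
  have hA : 0 ≤ A := (abs_nonneg _).trans h
  have h1 := norm_sin_le_mul (w/2) (A := A/2) (by
    have : (w/2).im = w.im/2 := by simp
    rw [this, abs_div]; simp; linarith)
  have h2 : Complex.cos w - 1 = -2 * Complex.sin (w/2)^2 := by
    have := Complex.cos_two_mul (w/2)
    rw [mul_div_cancel₀ _ (two_ne_zero)] at this
    rw [this, Complex.sin_sq]; ring
  rw [h2]
  simp only [norm_mul, norm_pow, norm_neg, Complex.norm_ofNat]
  have h3 : Real.exp A = Real.exp (A/2) ^ 2 := by rw [← Real.exp_nat_mul]; congr 1; push_cast; ring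
  rw [norm_div, Complex.norm_ofNat] at h1
  have h4 : ‖Complex.sin (w/2)‖^2 ≤ (‖w‖/2 * Real.exp (A/2))^2 := by gcongr
  rw [h3]
  nlinarith [sq_nonneg (‖w‖ * Real.exp (A/2))]

lemma im_two_x {x : ℝ} (hx : 0 < x) {z : ℂ} {η : ℝ} (h : |z.im| ≤ η) :
    |(2 * (x:ℂ) * z).im| ≤ 2 * η * x := by
  have : (2 * (x:ℂ) * z).im = 2 * x * z.im := by simp
  rw [this, abs_mul, abs_of_pos (by positivity)]
  nlinarith


/-- coefficient sequence -/
noncomputable def cc (n : ℕ) : ℝ := (1 - (2:ℝ)^(2*(n:ℤ)-1)) * ((bernoulli (2*n) : ℚ) : ℝ) / (Nat.factorial (2*n) : ℝ)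

noncomputable def cA : PowerSeries ℚ :=
  2 * bernoulliPowerSeries ℚ - PowerSeries.rescale 2 (bernoulliPowerSeries ℚ)

lemma cA_mul : cA * (PowerSeries.exp ℚ - PowerSeries.evalNegHom (PowerSeries.exp ℚ)) = 2 * PowerSeries.X := by
  have h1 := bernoulliPowerSeries_mul_exp_sub_one ℚ
  have h2 := congrArg (PowerSeries.rescale (2:ℚ)) h1
  have h3 := PowerSeries.exp_pow_eq_rescale_exp (A := ℚ) 2
  have h4 := PowerSeries.exp_mul_exp_neg_eq_one (A := ℚ)
  simp only [map_mul, map_sub, map_one, PowerSeries.rescale_X] at h2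
  norm_num at h3
  rw [← h3] at h2
  have h5 : (PowerSeries.C (2:ℚ)) = 2 := map_ofNat _ 2
  rw [h5] at h2
  unfold cA
  set E := PowerSeries.exp ℚ
  set F := PowerSeries.evalNegHom E
  set B := bernoulliPowerSeries ℚ
  set B2 := PowerSeries.rescale (2:ℚ) B
  have : (2 * B - B2) * (E - F) = (2 * B * (E - 1) * (E+1) - B2 * (E^2-1)) * F := by
    linear_combination (-(2 * B - B2) * E) * h4
  rw [this, h2, mul_assoc 2 B, h1]
  linear_combination (2 * PowerSeries.X) * h4

lemma cA_coeff (n : ℕ) : PowerSeries.coeff n cA = (2 - 2^n) * bernoulli n / n.factorial := by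
  unfold cA
  rw [map_sub, PowerSeries.coeff_rescale, two_mul, map_add]
  simp [bernoulliPowerSeries]
  ring

lemma cA_odd (n : ℕ) (hn : Odd n) : PowerSeries.coeff n cA = 0 := by
  rw [cA_coeff]
  rcases eq_or_ne n 1 with rfl | h
  · norm_num
  · rw [bernoulli_eq_zero_of_odd hn (by have := hn.pos; omega)]; simp

lemma cA_even (n : ℕ) : ((PowerSeries.coeff (2*n) cA : ℚ) : ℝ) = 2 * cc n := by
  rw [cA_coeff, cc, zpow_sub₀ (by norm_num)]
  have : (2:ℝ) ^ (2*(n:ℤ)) = 2^(2*n) := by norm_cast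
  rw [this]
  push_cast
  field_simp

lemma sum_even (N : ℕ) (u : ℝ) :
    ∑ i ∈ Finset.range (2*N+2), ((PowerSeries.coeff i cA : ℚ) : ℝ) * u^i
      = ∑ n ∈ Finset.range (N+1), 2 * cc n * u^(2*n) := by
  induction N with
  | zero =>
    simp only [mul_zero, zero_add, Finset.sum_range_succ, Finset.sum_range_zero, Finset.range_zero, Finset.sum_empty]
    rw [cA_odd 1 odd_one, ← cA_even 0]; simp
  | succ N ih =>
    rw [Finset.sum_range_succ _ (N+1), ← ih, show 2*(N+1)+2 = 2*N+2+1+1 by ring,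
      Finset.sum_range_succ, Finset.sum_range_succ, cA_odd (2*N+2+1) ⟨N+1, by ring⟩, ← cA_even (N+1)]
    simp [mul_add]

noncomputable def eS : PowerSeries ℚ := PowerSeries.exp ℚ - PowerSeries.evalNegHom (PowerSeries.exp ℚ)

lemma eS_coeff (n : ℕ) : PowerSeries.coeff n eS = 1 / n.factorial - (-1)^n / n.factorial := by
  unfold eS
  rw [map_sub, PowerSeries.evalNegHom, PowerSeries.coeff_rescale, PowerSeries.coeff_exp]
  simp
  ring

lemma poly_dvd (N : ℕ) : (Polynomial.X ^ (2*N+3) : Polynomial ℚ) ∣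
    (PowerSeries.trunc (2*N+2) cA) * (PowerSeries.trunc (2*N+3) eS) - 2 * Polynomial.X := by
  rw [Polynomial.X_pow_dvd_iff]
  intro d hd
  have h := congrArg (PowerSeries.coeff d) cA_mul
  change PowerSeries.coeff d (cA * eS) = _ at h
  rw [PowerSeries.coeff_mul] at h
  rw [Polynomial.coeff_sub, Polynomial.coeff_mul]
  have h2 : ∑ x ∈ Finset.HasAntidiagonal.antidiagonal d, (PowerSeries.trunc (2*N+2) cA).coeff x.1 * (PowerSeries.trunc (2*N+3) eS).coeff x.2
     = ∑ x ∈ Finset.HasAntidiagonal.antidiagonal d, PowerSeries.coeff x.1 cA * PowerSeries.coeff x.2 eS := by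
    refine Finset.sum_congr rfl fun x hx => ?_
    rw [Finset.HasAntidiagonal.mem_antidiagonal] at hx
    rw [PowerSeries.coeff_trunc, PowerSeries.coeff_trunc, if_pos (by omega : x.2 < 2*N+3)]
    split_ifs with h1
    · rfl
    · have : x.2 = 0 := by omega
      rw [this, eS_coeff]; simp
  rw [h2, h]
  have h3 : (2 : PowerSeries ℚ) = PowerSeries.C 2 := (map_ofNat _ 2).symm
  have h4 : (2 : Polynomial ℚ) = Polynomial.C 2 := (map_ofNat _ 2).symm
  rw [h3, h4, PowerSeries.coeff_C_mul, Polynomial.coeff_C_mul, PowerSeries.coeff_X, Polynomial.coeff_X]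
  simp [eq_comm]

lemma poly_bound (N : ℕ) : ∃ K : ℝ, 0 ≤ K ∧ ∀ u : ℝ, 0 < u → u ≤ 1 →
    |(∑ n ∈ Finset.range (N+1), 2 * cc n * u^(2*n)) *
      (∑ j ∈ Finset.range (2*N+3), ((1:ℝ) / j.factorial - (-1)^j / j.factorial) * u^j) - 2 * u| ≤ K * u^(2*N+3) := by
  obtain ⟨q, hq⟩ := poly_dvd N
  obtain ⟨K, hK⟩ := (isCompact_Icc (a := (0:ℝ)) (b := 1)).exists_bound_of_continuousOn
    (f := fun u => (q.map (algebraMap ℚ ℝ)).eval u) (by fun_prop)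
  refine ⟨K, (norm_nonneg _).trans (hK 0 (by simp)), fun u hu hu1 => ?_⟩
  have h := congrArg (fun p => (p.map (algebraMap ℚ ℝ)).eval u) hq
  simp only [Polynomial.map_sub, Polynomial.map_mul, Polynomial.eval_sub, Polynomial.eval_mul, Polynomial.map_X,
    Polynomial.map_pow, Polynomial.eval_pow, Polynomial.eval_X] at h
  have h5 : ∀ n (f : PowerSeries ℚ), ((PowerSeries.trunc n f).map (algebraMap ℚ ℝ)).eval u
      = ∑ i ∈ Finset.range n, ((PowerSeries.coeff i f : ℚ) : ℝ) * u^i := by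
    intro n f
    rw [Polynomial.eval_map, PowerSeries.eval₂_trunc_eq_sum_range]
    rfl
  rw [h5, h5, sum_even] at h
  simp only [eS_coeff] at h
  push_cast at h
  simp only [Polynomial.map_ofNat, Polynomial.eval_ofNat] at h
  rw [h, abs_mul, abs_of_pos (pow_pos hu _), mul_comm]
  gcongr
  exact hK u ⟨hu.le, hu1⟩

lemma sinh_rem (N : ℕ) : ∃ K : ℝ, 0 ≤ K ∧ ∀ u : ℝ, 0 < u →
    |1 / Real.sinh u - (∑ n ∈ Finset.range (N+1), 2 * cc n * u^(2*n)) / u| ≤ K * u^(2*N+1) := by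
  obtain ⟨K, hK0, hK⟩ := poly_bound N
  set M : ℝ := ∑ n ∈ Finset.range (N+1), |2 * cc n| with hM
  have hM0 : 0 ≤ M := Finset.sum_nonneg fun _ _ => abs_nonneg _
  set L : ℝ := ((2*N+3).succ : ℝ) / ((2*N+3).factorial * (2*N+3 : ℕ)) with hL
  have hL0 : 0 ≤ L := by positivity
  refine ⟨K + M * (L + L) + 1 + M, by positivity, fun u hu => ?_⟩
  have hs : u ≤ Real.sinh u := Real.self_le_sinh_iff.2 hu.le
  have hs0 : 0 < Real.sinh u := hu.trans_le hs
  set P := ∑ n ∈ Finset.range (N+1), 2 * cc n * u^(2*n) with hP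
  rcases le_total u 1 with h1 | h1
  · have hPM : |P| ≤ M := by
      refine (Finset.abs_sum_le_sum_abs _ _).trans (Finset.sum_le_sum fun n _ => ?_)
      rw [abs_mul, abs_of_pos (pow_pos hu _)]
      exact mul_le_of_le_one_right (abs_nonneg _) (pow_le_one₀ hu.le h1)
    have e1 := Real.exp_bound (x := u) (by rw [abs_of_pos hu]; exact h1) (n := 2*N+3) (by omega)
    have e2 := Real.exp_bound (x := -u) (by rw [abs_neg, abs_of_pos hu]; exact h1) (n := 2*N+3) (by omega)
    rw [abs_neg] at e2
    rw [abs_of_pos hu] at e1 e2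
    set S := ∑ j ∈ Finset.range (2*N+3), ((1:ℝ) / j.factorial - (-1)^j / j.factorial) * u^j with hS
    have hS' : S = ∑ m ∈ Finset.range (2*N+3), u^m / m.factorial - ∑ m ∈ Finset.range (2*N+3), (-u)^m / m.factorial := by
      rw [hS, ← Finset.sum_sub_distrib]
      refine Finset.sum_congr rfl fun j _ => ?_
      rw [neg_pow u j]; ring
    have e3 : |2 * Real.sinh u - S| ≤ (L + L) * u^(2*N+3) := by
      rw [hS', Real.sinh_eq]
      have : 2 * ((Real.exp u - Real.exp (-u))/2) - (∑ m ∈ Finset.range (2*N+3), u^m / m.factorial - ∑ m ∈ Finset.range (2*N+3), (-u)^m / m.factorial)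
        = (Real.exp u - ∑ m ∈ Finset.range (2*N+3), u^m / m.factorial) - (Real.exp (-u) - ∑ m ∈ Finset.range (2*N+3), (-u)^m / m.factorial) := by ring
      rw [this]
      refine (abs_sub _ _).trans ?_
      linarith
    have e4 := hK u hu h1
    have e5 : |2 * u - P * (2 * Real.sinh u)| ≤ (K + M * (L+L)) * u^(2*N+3) := by
      have : 2 * u - P * (2 * Real.sinh u) = -(P * S - 2 * u) - P * (2 * Real.sinh u - S) := by ring
      rw [this]
      refine (abs_sub _ _).trans ?_
      rw [abs_neg, abs_mul]
      have : |P| * |2 * Real.sinh u - S| ≤ M * ((L + L) * u^(2*N+3)) := by gcongr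
      linarith
    have e6 : 1 / Real.sinh u - P / u = (2 * u - P * (2 * Real.sinh u)) / (2 * u * Real.sinh u) := by
      field_simp
    rw [e6, abs_div, abs_of_pos (by positivity : 0 < 2 * u * Real.sinh u), div_le_iff₀ (by positivity)]
    refine e5.trans ?_
    have : u^(2*N+3) ≤ u^(2*N+1) * (2 * u * Real.sinh u) := by
      have : u^(2*N+3) = u^(2*N+1) * (u * u) := by ring
      rw [this]; gcongr; nlinarith
    calc (K + M * (L+L)) * u^(2*N+3) ≤ (K + M * (L+L)) * (u^(2*N+1) * (2 * u * Real.sinh u)) := by gcongr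
      _ ≤ (K + M * (L + L) + 1 + M) * (u^(2*N+1) * (2 * u * Real.sinh u)) := by
          apply mul_le_mul_of_nonneg_right _ (by positivity); linarith
      _ = _ := by ring
  · have hPM : |P / u| ≤ M * u^(2*N+1) := by
      rw [abs_div, abs_of_pos hu, div_le_iff₀ hu]
      refine (Finset.abs_sum_le_sum_abs _ _).trans ?_
      rw [hM, Finset.sum_mul, Finset.sum_mul]
      refine (Finset.sum_le_sum fun n hn => ?_)
      rw [abs_mul, abs_of_pos (pow_pos hu _), mul_assoc, ← pow_succ]
      gcongr
      · have := Finset.mem_range.1 hn; omega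
    have h2 : |1 / Real.sinh u| ≤ 1 * u^(2*N+1) := by
      rw [abs_of_pos (by positivity), one_mul]
      refine le_trans ?_ (one_le_pow₀ h1)
      rw [div_le_one hs0]; linarith
    have h3 : 0 ≤ (K + M * (L+L)) * u^(2*N+1) := by positivity
    refine (abs_sub _ _).trans ?_
    linarith


lemma cc_zero : cc 0 = 1/2 := by unfold cc; norm_num

lemma k_bound : ∃ K : ℝ, 0 ≤ K ∧ ∀ u : ℝ, 0 < u → |1 / Real.sinh u - 1 / u| ≤ K * u := by
  obtain ⟨K, h0, h⟩ := sinh_rem 0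
  refine ⟨K, h0, fun u hu => ?_⟩
  simpa [cc_zero] using h u hu

lemma k_int : IntegrableOn (fun x : ℝ => (1 / Real.sinh x - 1 / x) / x) (Ioi 0) := by
  obtain ⟨K, h0, h⟩ := k_bound
  have hm : ∀ s : Set ℝ, AEStronglyMeasurable (fun x : ℝ => (1 / Real.sinh x - 1 / x) / x) (volume.restrict s) := by
    intro s
    apply Measurable.aestronglyMeasurable
    have := Real.measurable_sinh
    fun_prop
  rw [← Ioc_union_Ioi_eq_Ioi (zero_le_one (α := ℝ))]
  refine IntegrableOn.union ?_ ?_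
  · refine Integrable.mono' (g := fun _ => K) (by simp) (hm _) ?_
    refine (ae_restrict_iff' measurableSet_Ioc).2 (ae_of_all _ fun x hx => ?_)
    rw [norm_div, Real.norm_eq_abs, Real.norm_of_nonneg hx.1.le, div_le_iff₀ hx.1]
    exact h x hx.1
  · have := integrableOn_Ioi_rpow_of_lt (a := -2) (by norm_num) (zero_lt_one (α := ℝ))
    refine Integrable.mono' this (hm _) ?_
    refine (ae_restrict_iff' measurableSet_Ioi).2 (ae_of_all _ fun x hx => ?_)
    have hx : 1 < x := hx
    have hx0 : 0 < x := by linarith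
    have hs : x ≤ Real.sinh x := Real.self_le_sinh_iff.2 hx0.le
    have h1 : 1 / Real.sinh x ≤ 1 / x := one_div_le_one_div_of_le hx0 hs
    have h2 : 0 < 1 / Real.sinh x := by positivity
    rw [norm_div, Real.norm_eq_abs, Real.norm_of_nonneg hx0.le, abs_of_nonpos (by linarith)]
    rw [Real.rpow_neg hx0.le]
    have : (x ^ (2:ℝ))⁻¹ = (1/x)/x := by
      rw [Real.rpow_two]; field_simp
    rw [this]
    gcongr
    linarith

lemma k_val : ∫ x in Ioi (0:ℝ), (1 / Real.sinh x - 1 / x) / x = - Real.log 2 := by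
  let f : ℝ → ℝ := fun x => Real.cosh x / Real.sinh x - 1 / x
  have hfx : ∀ x ∈ Ioi (0:ℝ), x⁻¹ • (f ((1/2) * x) - f (1 * x)) = (1 / Real.sinh x - 1 / x) / x := by
    intro x hx
    have hx : 0 < x := hx
    have h1 : 0 < Real.sinh ((1/2)*x) := Real.sinh_pos_iff.2 (by positivity)
    have h2 : 0 < Real.sinh x := Real.sinh_pos_iff.2 (by positivity)
    have h3 : 0 < Real.cosh ((1/2)*x) := Real.cosh_pos _
    have e1 := Real.sinh_two_mul ((1/2)*x)
    have e2 := Real.cosh_two_mul ((1/2)*x)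
    have e3 := Real.cosh_sq ((1/2)*x)
    rw [show 2 * ((1/2)*x) = x by ring] at e1 e2
    simp only [f, one_mul, smul_eq_mul]
    rw [e1, e2]
    generalize Real.sinh ((1/2)*x) = s at *
    generalize Real.cosh ((1/2)*x) = c at *
    field_simp
    linear_combination x * e3
  have hc : ContinuousOn f (Ioi 0) := by
    intro x hx
    have h2 : Real.sinh x ≠ 0 := (Real.sinh_pos_iff.2 hx).ne'
    have h3 : x ≠ 0 := ne_of_gt hx
    apply ContinuousAt.continuousWithinAt
    have := Real.continuous_sinh.continuousAt (x := x)
    have := Real.continuous_cosh.continuousAt (x := x)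
    fun_prop (disch := assumption)
  have hf : LocallyIntegrableOn f (Ioi 0) := hc.locallyIntegrableOn measurableSet_Ioi
  obtain ⟨K, h0, h⟩ := k_bound
  have hcs : ∀ x : ℝ, 0 < x → |Real.cosh x / Real.sinh x - 1 / Real.sinh x| ≤ Real.sinh x := by
    intro x hx
    have h2 : 0 < Real.sinh x := Real.sinh_pos_iff.2 (by positivity)
    have h3 := Real.one_le_cosh x
    rw [← sub_div, abs_div, abs_of_pos h2, abs_of_nonneg (by linarith), div_le_iff₀ h2]
    have := Real.cosh_sq x
    nlinarith
  have hL : Tendsto f (𝓝[>] 0) (𝓝 0) := by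
    have hb : Tendsto (fun x : ℝ => K * x + Real.sinh x) (𝓝[>] 0) (𝓝 0) := by
      have : Continuous (fun x : ℝ => K * x + Real.sinh x) := by
        have := Real.continuous_sinh
        fun_prop
      have h := this.tendsto 0
      simp at h
      exact h.mono_left nhdsWithin_le_nhds
    refine squeeze_zero_norm' ?_ hb
    filter_upwards [self_mem_nhdsWithin] with x hx
    have hx : 0 < x := hx
    have : f x = (1 / Real.sinh x - 1 / x) + (Real.cosh x / Real.sinh x - 1 / Real.sinh x) := by simp only [f]; ring
    rw [this]
    exact (norm_add_le _ _).trans (add_le_add (h x hx) (hcs x hx))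
  have hR : Tendsto f atTop (𝓝 1) := by
    have hb : Tendsto (fun x : ℝ => 1 / x + 1 / x) atTop (𝓝 0) := by
      simpa using (tendsto_inv_atTop_zero (𝕜 := ℝ)).add tendsto_inv_atTop_zero
    rw [tendsto_iff_norm_sub_tendsto_zero]
    refine squeeze_zero' (Eventually.of_forall fun _ => norm_nonneg _) ?_ hb
    filter_upwards [eventually_gt_atTop 0] with x hx
    have h2 : 0 < Real.sinh x := Real.sinh_pos_iff.2 (by positivity)
    have hs : x ≤ Real.sinh x := Real.self_le_sinh_iff.2 hx.le
    have e : f x - 1 = Real.exp (-x) / Real.sinh x - 1 / x := by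
      rw [← Real.cosh_sub_sinh]; simp only [f]; field_simp; ring
    rw [e]
    refine (norm_sub_le _ _).trans ?_
    rw [Real.norm_of_nonneg (by positivity), Real.norm_of_nonneg (by positivity)]
    gcongr
    simpa using hx.le
  have key := Frullani.integral_Ioi_eq (a := 1/2) (b := 1) hf (by norm_num) one_pos hL hR
    (k_int.congr_fun (fun x hx => (hfx x hx).symm) measurableSet_Ioi)
  rw [setIntegral_congr_fun measurableSet_Ioi hfx] at key
  rw [key]; norm_num


lemma norm_sin_sub_le (w : ℂ) {A : ℝ} (h : |w.im| ≤ A) :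
    ‖Complex.sin w - w‖ ≤ ‖w‖ ^ 3 * Real.exp A := by
  have hc : Convex ℝ ({v : ℂ | |v.im| ≤ A} ∩ Metric.closedBall 0 ‖w‖) := by
    have : {v : ℂ | |v.im| ≤ A} = Complex.imLm ⁻¹' (Icc (-A) A) := by ext v; simp [abs_le]
    rw [this]; exact ((convex_Icc _ _).linear_preimage _).inter (convex_closedBall _ _)
  have := hc.norm_image_sub_le_of_norm_hasDerivWithin_le (f := fun w => Complex.sin w - w)
    (f' := fun w => Complex.cos w - 1)
    (x := 0) (y := w) (C := ‖w‖^2 * Real.exp A)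
    (fun v hv => ((Complex.hasDerivAt_sin v).sub (hasDerivAt_id v)).hasDerivWithinAt)
    (fun v hv => (norm_cos_sub_one_le v hv.1).trans (by
      have : ‖v‖ ≤ ‖w‖ := by simpa using hv.2
      gcongr))
    ⟨by change |(0:ℂ).im| ≤ A; simpa using (abs_nonneg _).trans h, by simp⟩ ⟨h, by simp⟩
  simp only [Complex.sin_zero, sub_zero] at this
  calc _ ≤ _ := this
    _ = _ := by ring

def Dom (f : ℂ → ℝ → ℂ) : Prop := (∀ z, Measurable (f z)) ∧ ∀ η : ℝ, η < 1/2 → ∀ R : ℝ, ∃ g : ℝ → ℝ,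
  IntegrableOn g (Ioi 0) ∧ ∀ z : ℂ, |z.im| ≤ η → ‖z‖ ≤ R → ∀ x : ℝ, 0 < x → ‖f z x‖ ≤ g x

lemma Dom.int {f : ℂ → ℝ → ℂ} (hf : Dom f) {z : ℂ} (hz : |z.im| < 1/2) : IntegrableOn (f z) (Ioi 0) := by
  obtain ⟨g, hg, h⟩ := hf.2 _ hz ‖z‖
  refine Integrable.mono' hg (hf.1 z).aestronglyMeasurable ?_
  exact (ae_restrict_iff' measurableSet_Ioi).2 (ae_of_all _ fun x hx => h z le_rfl le_rfl x hx)

lemma Dom.deriv {f f' : ℂ → ℝ → ℂ} (hf : Dom f) (hf' : Dom f')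
    (hd : ∀ z, ∀ x : ℝ, 0 < x → HasDerivAt (fun w => f w x) (f' z x) z) {z : ℂ} (hz : |z.im| < 1/2) :
    HasDerivAt (fun w => ∫ x in Ioi (0:ℝ), f w x) (∫ x in Ioi (0:ℝ), f' z x) z := by
  obtain ⟨η, h1, h2⟩ := exists_between hz
  obtain ⟨g, hg, h⟩ := hf'.2 η h2 (‖z‖ + 1)
  have hs : {w : ℂ | |w.im| < η} ∩ Metric.ball z 1 ∈ 𝓝 z := by
    refine inter_mem (IsOpen.mem_nhds ?_ h1) (Metric.ball_mem_nhds _ one_pos)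
    exact isOpen_lt (by fun_prop) continuous_const
  refine (hasDerivAt_integral_of_dominated_loc_of_deriv_le (bound := g) hs
    (Eventually.of_forall fun w => (hf.1 w).aestronglyMeasurable) (hf.int hz) (hf'.1 z).aestronglyMeasurable
    ?_ hg ?_).2
  · refine (ae_restrict_iff' measurableSet_Ioi).2 (ae_of_all _ fun x hx w hw => h w (le_of_lt hw.1) ?_ x hx)
    have : ‖w - z‖ < 1 := by simpa [dist_eq_norm] using hw.2
    have h3 := norm_add_le (w - z) z
    simp at h3
    linarith
  · exact (ae_restrict_iff' measurableSet_Ioi).2 (ae_of_all _ fun x hx w hw => hd w x hx)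

noncomputable def fF (n : ℕ) (z : ℂ) (x : ℝ) : ℂ := (x:ℂ)^(2*n) * Complex.sin (2 * (x:ℂ) * z) / (Real.sinh x : ℂ)
noncomputable def fC (n : ℕ) (z : ℂ) (x : ℝ) : ℂ := (x:ℂ)^(2*n+1) * Complex.cos (2 * (x:ℂ) * z) / (Real.sinh x : ℂ)
noncomputable def gA (z : ℂ) (x : ℝ) : ℂ := (Complex.sin (2 * (x:ℂ) * z) / ((x:ℂ) * (Real.sinh x : ℂ)) - 2 * z / (x:ℂ)) / (x:ℂ)
noncomputable def gB (z : ℂ) (x : ℝ) : ℂ := (2 * Complex.cos (2 * (x:ℂ) * z) / (Real.sinh x : ℂ) - 2 / (x:ℂ)) / (x:ℂ)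

lemma norm_two_x {x : ℝ} (hx : 0 < x) {z : ℂ} {R : ℝ} (h : ‖z‖ ≤ R) : ‖2 * (x:ℂ) * z‖ ≤ 2 * x * R := by
  rw [norm_mul, norm_mul, Complex.norm_real, Real.norm_of_nonneg hx.le]; simp; gcongr

lemma meas_sinh : Measurable (fun x : ℝ => (Real.sinh x : ℂ)) :=
  Complex.measurable_ofReal.comp Real.measurable_sinh
lemma meas_sin : Measurable Complex.sin := Complex.continuous_sin.measurable
lemma meas_cos : Measurable Complex.cos := Complex.continuous_cos.measurable

lemma dom_fF (n : ℕ) : Dom (fF n) := by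
  refine ⟨fun z => ?_, fun η hη R => ⟨fun x => 2 * R * (x^(2*n+1) * Real.exp (2*η*x) / Real.sinh x),
    (kernel_integrable (2*n) (a := 2*η) (by linarith)).const_mul _, fun z hz hR x hx => ?_⟩⟩
  · unfold fF
    have := meas_sinh; have := meas_sin
    fun_prop
  · have hs : 0 < Real.sinh x := Real.sinh_pos_iff.2 hx
    unfold fF
    rw [norm_div, norm_mul, norm_pow, Complex.norm_real, Complex.norm_real, Real.norm_of_nonneg hs.le, Real.norm_of_nonneg hx.le]
    have h1 := norm_sin_le_mul _ (im_two_x hx hz)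
    have h2 := norm_two_x hx hR
    calc _ ≤ x^(2*n) * (2 * x * R * Real.exp (2*η*x)) / Real.sinh x := by
            gcongr; exact h1.trans (by gcongr)
      _ = _ := by ring

lemma dom_fC (n : ℕ) : Dom (fC n) := by
  refine ⟨fun z => ?_, fun η hη R => ⟨fun x => (x^(2*n+1) * Real.exp (2*η*x) / Real.sinh x),
    (kernel_integrable (2*n) (a := 2*η) (by linarith)), fun z hz hR x hx => ?_⟩⟩
  · unfold fC
    have := meas_sinh; have := meas_cos
    fun_prop
  · have hs : 0 < Real.sinh x := Real.sinh_pos_iff.2 hx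
    unfold fC
    rw [norm_div, norm_mul, norm_pow, Complex.norm_real, Complex.norm_real, Real.norm_of_nonneg hs.le, Real.norm_of_nonneg hx.le]
    have h1 := norm_cos_le_exp _ (im_two_x hx hz)
    beta_reduce
    gcongr

lemma dom_gA : Dom gA := by
  have hint : ∀ η : ℝ, η < 1/2 → ∀ R : ℝ, IntegrableOn (fun x : ℝ => 8 * R^3 * (x^(0+1) * Real.exp (2*η*x) / Real.sinh x)
    + 2 * R * ‖(1 / Real.sinh x - 1 / x) / x‖) (Ioi 0) := fun η hη R =>
    ((kernel_integrable 0 (a := 2*η) (by linarith)).const_mul (8 * R^3)).add (k_int.norm.const_mul (2 * R))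
  refine ⟨fun z => ?_, fun η hη R => ⟨fun x => 8 * R^3 * (x^(0+1) * Real.exp (2*η*x) / Real.sinh x)
    + 2 * R * ‖(1 / Real.sinh x - 1 / x) / x‖,
    hint η hη R, fun z hz hR x hx => ?_⟩⟩
  · unfold gA
    have := meas_sinh; have := meas_sin
    fun_prop
  · have hs : 0 < Real.sinh x := Real.sinh_pos_iff.2 hx
    have h1 := norm_sin_sub_le _ (im_two_x hx hz)
    have h2 := norm_two_x hx hR
    have hsc : (Real.sinh x : ℂ) ≠ 0 := by exact_mod_cast hs.ne'
    have hxc : (x : ℂ) ≠ 0 := by exact_mod_cast hx.ne'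
    have e : gA z x = (Complex.sin (2 * (x:ℂ) * z) - 2 * x * z) / ((x^2 * Real.sinh x : ℝ) : ℂ)
      + 2 * z * (((1 / Real.sinh x - 1 / x) / x : ℝ) : ℂ) := by
      unfold gA
      rw [Complex.ofReal_mul, Complex.ofReal_pow, Complex.ofReal_div, Complex.ofReal_sub, Complex.ofReal_div, Complex.ofReal_div, Complex.ofReal_one]
      field_simp
      ring
    rw [e]
    refine (norm_add_le _ _).trans (add_le_add ?_ ?_)
    · rw [norm_div, Complex.norm_real, Real.norm_of_nonneg (by positivity)]
      calc _ ≤ ((2 * x * R)^3 * Real.exp (2*η*x)) / (x^2 * Real.sinh x) := by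
            gcongr; exact h1.trans (by gcongr)
        _ = _ := by field_simp; ring
    · rw [norm_mul, norm_mul, Complex.norm_real]; simp only [Complex.norm_ofNat]; gcongr

lemma dom_gB : Dom gB := by
  have hint : ∀ η : ℝ, η < 1/2 → ∀ R : ℝ, IntegrableOn (fun x : ℝ => 8 * R^2 * (x^(0+1) * Real.exp (2*η*x) / Real.sinh x)
    + 2 * ‖(1 / Real.sinh x - 1 / x) / x‖) (Ioi 0) := fun η hη R =>
    ((kernel_integrable 0 (a := 2*η) (by linarith)).const_mul (8 * R^2)).add (k_int.norm.const_mul (2))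
  refine ⟨fun z => ?_, fun η hη R => ⟨fun x => 8 * R^2 * (x^(0+1) * Real.exp (2*η*x) / Real.sinh x)
    + 2 * ‖(1 / Real.sinh x - 1 / x) / x‖,
    hint η hη R, fun z hz hR x hx => ?_⟩⟩
  · unfold gB
    have := meas_sinh; have := meas_cos
    fun_prop
  · have hs : 0 < Real.sinh x := Real.sinh_pos_iff.2 hx
    have h1 := norm_cos_sub_one_le _ (im_two_x hx hz)
    have h2 := norm_two_x hx hR
    have hsc : (Real.sinh x : ℂ) ≠ 0 := by exact_mod_cast hs.ne'
    have hxc : (x : ℂ) ≠ 0 := by exact_mod_cast hx.ne'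
    have e : gB z x = 2 * (Complex.cos (2 * (x:ℂ) * z) - 1) / ((x * Real.sinh x : ℝ) : ℂ)
      + 2 * (((1 / Real.sinh x - 1 / x) / x : ℝ) : ℂ) := by
      unfold gB
      rw [Complex.ofReal_mul, Complex.ofReal_div, Complex.ofReal_sub, Complex.ofReal_div, Complex.ofReal_div, Complex.ofReal_one]
      field_simp
      ring
    rw [e]
    refine (norm_add_le _ _).trans (add_le_add ?_ ?_)
    · rw [norm_div, norm_mul, Complex.norm_real, Real.norm_of_nonneg (by positivity)]
      calc _ ≤ 2 * ((2 * x * R)^2 * Real.exp (2*η*x)) / (x * Real.sinh x) := by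
            simp only [Complex.norm_ofNat]
            gcongr; exact h1.trans (by gcongr)
        _ = _ := by field_simp; ring
    · rw [norm_mul, Complex.norm_real]; simp only [Complex.norm_ofNat]; gcongr

noncomputable def IF (n : ℕ) (z : ℂ) : ℂ := ∫ x in Ioi (0:ℝ), fF n z x
noncomputable def IC (n : ℕ) (z : ℂ) : ℂ := ∫ x in Ioi (0:ℝ), fC n z x
noncomputable def IA (z : ℂ) : ℂ := ∫ x in Ioi (0:ℝ), gA z x
noncomputable def IB (z : ℂ) : ℂ := ∫ x in Ioi (0:ℝ), gB z x

lemma Dom.smul {f : ℂ → ℝ → ℂ} (hf : Dom f) (c : ℂ) : Dom (fun z x => c * f z x) := by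
  refine ⟨fun z => (hf.1 z).const_mul c, fun η hη R => ?_⟩
  obtain ⟨g, hg, h⟩ := hf.2 η hη R
  refine ⟨fun x => ‖c‖ * g x, hg.const_mul _, fun z hz hR x hx => ?_⟩
  rw [norm_mul]; beta_reduce; gcongr; exact h z hz hR x hx

lemma hd_lin (x : ℝ) (z : ℂ) : HasDerivAt (fun w : ℂ => 2 * (x:ℂ) * w) (2 * (x:ℂ)) z := by
  simpa using (hasDerivAt_id z).const_mul (2 * (x:ℂ))

lemma IF_deriv (n : ℕ) {z : ℂ} (hz : |z.im| < 1/2) : HasDerivAt (IF n) (2 * IC n z) z := by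
  have := (dom_fF n).deriv ((dom_fC n).smul 2) (fun z x hx => by
    have h := (((hd_lin x z).csin).const_mul ((x:ℂ)^(2*n))).div_const (Real.sinh x : ℂ)
    refine h.congr_deriv ?_
    unfold fC; ring) hz
  rw [integral_const_mul] at this
  exact this

lemma IC_deriv (n : ℕ) {z : ℂ} (hz : |z.im| < 1/2) : HasDerivAt (IC n) (-2 * IF (n+1) z) z := by
  have := (dom_fC n).deriv ((dom_fF (n+1)).smul (-2)) (fun z x hx => by
    have h := (((hd_lin x z).ccos).const_mul ((x:ℂ)^(2*n+1))).div_const (Real.sinh x : ℂ)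
    refine h.congr_deriv ?_
    unfold fF; ring) hz
  rw [integral_const_mul] at this
  exact this

lemma IA_deriv {z : ℂ} (hz : |z.im| < 1/2) : HasDerivAt IA (IB z) z := by
  exact dom_gA.deriv dom_gB (fun z x hx => by
    have hs : 0 < Real.sinh x := Real.sinh_pos_iff.2 hx
    have hsc : (Real.sinh x : ℂ) ≠ 0 := by exact_mod_cast hs.ne'
    have hxc : (x : ℂ) ≠ 0 := by exact_mod_cast hx.ne'
    have h := ((((hd_lin x z).csin).div_const ((x:ℂ) * (Real.sinh x : ℂ))).sub
      (((hasDerivAt_id z).const_mul 2).div_const (x:ℂ))).div_const (x:ℂ)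
    refine h.congr_deriv ?_
    unfold gB; field_simp) hz

lemma IB_deriv {z : ℂ} (hz : |z.im| < 1/2) : HasDerivAt IB (-4 * IF 0 z) z := by
  have := dom_gB.deriv ((dom_fF 0).smul (-4)) (fun z x hx => by
    have hs : 0 < Real.sinh x := Real.sinh_pos_iff.2 hx
    have hsc : (Real.sinh x : ℂ) ≠ 0 := by exact_mod_cast hs.ne'
    have hxc : (x : ℂ) ≠ 0 := by exact_mod_cast hx.ne'
    have h := (((((hd_lin x z).ccos).const_mul 2).div_const (Real.sinh x : ℂ)).sub_const (2 / (x:ℂ))).div_const (x:ℂ)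
    refine h.congr_deriv ?_
    unfold fF; field_simp; ring) hz
  rw [integral_const_mul] at this
  exact this

lemma IA_zero : IA 0 = 0 := by simp [IA, gA]

lemma IB_zero : IB 0 = -2 * (Real.log 2 : ℂ) := by
  have : ∀ x : ℝ, gB 0 x = 2 * (((1 / Real.sinh x - 1 / x) / x : ℝ) : ℂ) := by
    intro x; unfold gB; rw [Complex.ofReal_div, Complex.ofReal_sub, Complex.ofReal_div, Complex.ofReal_div, Complex.ofReal_one]; simp; ring
  unfold IB
  simp_rw [this]
  rw [integral_const_mul, integral_complex_ofReal, k_val]; push_cast; ring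


lemma hs_congr {f g : ℕ → ℂ} {a b : ℂ} (h : HasSum g b) (hf : ∀ k, f k = g k) (hv : a = b) : HasSum f a := by
  rw [hv, funext hf]; exact h

noncomputable def tk (z : ℂ) (k : ℕ) (x : ℝ) : ℂ := 2 * Complex.sin (2 * (x:ℂ) * z) * (Real.exp (-(2*k+1) * x) : ℂ)

lemma tk_hasSum (z : ℂ) {x : ℝ} (hx : 0 < x) : HasSum (fun k => tk z k x) (fF 0 z x) := by
  have hr : Real.exp (-2*x) < 1 := by rw [Real.exp_lt_one_iff]; linarith
  have h := (hasSum_geometric_of_lt_one (Real.exp_pos (-2*x)).le hr).mul_left (Real.exp (-x))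
  have h2 := (Complex.hasSum_ofReal.2 h).mul_left (2 * Complex.sin (2 * (x:ℂ) * z))
  refine hs_congr h2 (fun k => ?_) ?_
  · 
    unfold tk
    congr 2
    rw [← Real.exp_nat_mul, ← Real.exp_add]
    congr 1; ring
  · unfold fF
    have hs : 0 < Real.sinh x := Real.sinh_pos_iff.2 hx
    have : Real.exp (-x) * (1 - Real.exp (-2*x))⁻¹ = 1 / (2 * Real.sinh x) := by
      rw [Real.sinh_eq, show -2*x = -x + -x by ring, Real.exp_add, Real.exp_neg] 
      have h1 : 1 < Real.exp x := by rwa [Real.one_lt_exp_iff]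
      have h2 : Real.exp x - (Real.exp x)⁻¹ ≠ 0 := by
        have : (Real.exp x)⁻¹ < 1 := inv_lt_one_of_one_lt₀ h1
        linarith
      have h3 : 1 - (Real.exp x)⁻¹ * (Real.exp x)⁻¹ ≠ 0 := by
        have : (Real.exp x)⁻¹ < 1 := inv_lt_one_of_one_lt₀ h1
        have : 0 < (Real.exp x)⁻¹ := by positivity
        nlinarith
      rw [mul_inv_eq_iff_eq_mul₀ h3]
      have h4 : Real.exp x ^ 2 - 1 ≠ 0 := by nlinarith
      field_simp
    rw [this]
    have hsc : (Real.sinh x : ℂ) ≠ 0 := by exact_mod_cast hs.ne'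
    push_cast at hsc ⊢
    field_simp

lemma tk_bound {z : ℂ} (k : ℕ) {x : ℝ} (hx : 0 < x) :
    ‖tk z k x‖ ≤ 4 * ‖z‖ * (x^1 * Real.exp (-(2*k+1-2*|z.im|) * x)) := by
  unfold tk
  have h1 := norm_sin_le_mul _ (im_two_x hx (le_refl |z.im|))
  have h2 := norm_two_x hx (le_refl ‖z‖)
  rw [norm_mul, norm_mul, Complex.norm_real, Real.norm_of_nonneg (Real.exp_pos _).le, Complex.norm_ofNat]
  have : Real.exp (-(2*k+1-2*|z.im|) * x) = Real.exp (2 * |z.im| * x) * Real.exp (-(2*k+1) * x) := by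
    rw [← Real.exp_add]; congr 1; ring
  rw [this]
  calc _ ≤ 2 * (2 * x * ‖z‖ * Real.exp (2 * |z.im| * x)) * Real.exp (-(2*k+1) * x) := by
        gcongr; exact h1.trans (by gcongr)
    _ = _ := by ring

lemma int_x_exp {c : ℝ} (hc : 0 < c) : ∫ x in Ioi (0:ℝ), x^1 * Real.exp (-c * x) = (1/c)^2 := by
  have := Real.integral_rpow_mul_exp_neg_mul_Ioi (a := 2) (r := c) (by norm_num) hc
  norm_num at this
  simpa using this

lemma tk_int {z : ℂ} (hz : |z.im| < 1/2) (k : ℕ) : IntegrableOn (tk z k) (Ioi 0) := by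
  have hc : 0 < 2*(k:ℝ)+1-2*|z.im| := by have : (0:ℝ) ≤ k := k.cast_nonneg
                                         linarith
  refine Integrable.mono' ((integrable_pow_exp 1 hc).const_mul (4 * ‖z‖)) ?_ ?_
  · apply Measurable.aestronglyMeasurable
    unfold tk
    have := meas_sin
    fun_prop
  · exact (ae_restrict_iff' measurableSet_Ioi).2 (ae_of_all _ fun x hx => tk_bound k hx)

lemma tk_val {z : ℂ} (hz : |z.im| < 1/2) (k : ℕ) :
    ∫ x in Ioi (0:ℝ), tk z k x = Complex.I / ((2*k+1) + 2*Complex.I*z) - Complex.I / ((2*k+1) - 2*Complex.I*z) := by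
  have hk : (0:ℝ) ≤ k := k.cast_nonneg
  have hz' := abs_lt.1 hz
  have r1 : (-((2*k+1) + 2*Complex.I*z)).re < 0 := by simp; linarith
  have r2 : (-((2*k+1) - 2*Complex.I*z)).re < 0 := by simp; linarith
  have e : ∀ x : ℝ, tk z k x = Complex.I * Complex.exp (-((2*k+1) + 2*Complex.I*z) * x)
      - Complex.I * Complex.exp (-((2*k+1) - 2*Complex.I*z) * x) := by
    intro x
    unfold tk
    rw [Complex.two_sin, Complex.ofReal_exp, mul_right_comm, sub_mul, ← Complex.exp_add, ← Complex.exp_add, mul_comm _ Complex.I, mul_sub]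
    congr 3 <;> (push_cast; ring)
  simp_rw [e]
  rw [integral_sub, integral_const_mul, integral_const_mul, integral_exp_mul_complex_Ioi r1, integral_exp_mul_complex_Ioi r2]
  · simp only [Complex.ofReal_zero, mul_zero, Complex.exp_zero]
    rw [neg_div_neg_eq, neg_div_neg_eq]; ring
  · exact (integrableOn_exp_mul_complex_Ioi r1 0).const_mul _
  · exact (integrableOn_exp_mul_complex_Ioi r2 0).const_mul _

lemma IF0_hasSum {z : ℂ} (hz : |z.im| < 1/2) :
    HasSum (fun k : ℕ => Complex.I / ((2*k+1) + 2*Complex.I*z) - Complex.I / ((2*k+1) - 2*Complex.I*z)) (IF 0 z) := by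
  have h := hasSum_integral_of_summable_integral_norm (F := tk z) (μ := volume.restrict (Ioi 0)) (tk_int hz) ?_
  · simp_rw [tk_val hz] at h
    refine hs_congr h (fun k => rfl) ?_
    exact setIntegral_congr_fun measurableSet_Ioi fun x (hx : 0 < x) => (tk_hasSum z hx).tsum_eq.symm
  · set a := 1 - 2*|z.im| with ha
    have ha0 : 0 < a := by linarith
    have hs : Summable (fun k : ℕ => 4 * ‖z‖ * (1/a)^2 * (1 / ((k:ℝ)+1)^2)) := by
      apply Summable.mul_left
      have := (summable_nat_add_iff 1).2 (Real.summable_one_div_nat_pow.2 (one_lt_two))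
      simpa using this
    refine Summable.of_nonneg_of_le (fun k => integral_nonneg fun _ => norm_nonneg _) (fun k => ?_) hs
    have hk : (0:ℝ) ≤ k := k.cast_nonneg
    have hc : 0 < 2*(k:ℝ)+1-2*|z.im| := by linarith
    calc ∫ x in Ioi (0:ℝ), ‖tk z k x‖ ≤ ∫ x in Ioi (0:ℝ), 4 * ‖z‖ * (x^1 * Real.exp (-(2*k+1-2*|z.im|) * x)) := by
          refine setIntegral_mono_on (tk_int hz k).norm ((integrable_pow_exp 1 hc).const_mul _) measurableSet_Ioi
            fun x hx => tk_bound k hx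
      _ = 4 * ‖z‖ * (1 / (2*k+1-2*|z.im|))^2 := by rw [integral_const_mul, int_x_exp hc]
      _ ≤ 4 * ‖z‖ * (1 / (a * (k+1)))^2 := by
          gcongr
          have := abs_nonneg z.im
          nlinarith
      _ = _ := by field_simp

lemma IF0_val {z : ℂ} (hz : |z.im| < 1/2) :
    IF 0 z = Real.pi * Complex.exp (2*Real.pi*z) / (1 + Complex.exp (2*Real.pi*z)) - Real.pi / 2 := by
  rcases eq_or_ne z 0 with rfl | hz0
  · simp [IF, fF]; ring
  have hz' := abs_lt.1 hz
  have hint : ∀ n : ℤ, (n:ℂ) ≠ 2 * (Complex.I * z) := by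
    intro n hn
    have h1 := congrArg Complex.re hn
    have h2 := congrArg Complex.im hn
    simp at h1 h2
    have : n = 0 := by
      have a1 : (n:ℝ) < 1 := by linarith
      have a2 : (-1:ℝ) < n := by linarith
      have : n < 1 := by exact_mod_cast a1
      have : -1 < n := by exact_mod_cast a2
      omega
    subst this
    simp at h1
    exact hz0 (Complex.ext h2 h1)
  set w := Complex.I * z with hw
  have hw2 : 2 * w ∈ Complex.integerComplement := by
    rintro ⟨n, hn⟩; exact hint n hn
  have hw1 : w ∈ Complex.integerComplement := by
    rintro ⟨n, hn⟩; apply hint (2*n); rw [← hn]; push_cast; ring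
  have s1 : HasSum (fun n : ℕ => 1/(w-(n+1)) + 1/(w+(n+1))) (Real.pi * Complex.cot (Real.pi * w) - 1/w) := by
    rw [cot_series_rep' hw1]; exact (summable_cotTerm hw1).hasSum
  have s2 : HasSum (fun n : ℕ => 1/(2*w-(n+1)) + 1/(2*w+(n+1))) (Real.pi * Complex.cot (Real.pi * (2*w)) - 1/(2*w)) := by
    rw [cot_series_rep' hw2]; exact (summable_cotTerm hw2).hasSum
  have s0 := (IF0_hasSum hz).mul_left (-Complex.I)
  have s3 : HasSum (fun n : ℕ => 1/(2*w-(n+1)) + 1/(2*w+(n+1)))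
      (-Complex.I * IF 0 z + (Real.pi * Complex.cot (Real.pi * w) - 1/w) / 2) := by
    refine HasSum.even_add_odd ?_ ?_
    · refine hs_congr s0 (fun k => ?_) rfl
      push_cast
      have d1 : (2*(k:ℂ)+1) + 2*w ≠ 0 := fun h => hint (-(2*k+1)) (by push_cast; linear_combination -h)
      have d2 : (2*(k:ℂ)+1) - 2*w ≠ 0 := fun h => hint ((2*k+1)) (by push_cast; linear_combination h)
      have d3 : 2*w - (2*(k:ℂ)+1) ≠ 0 := fun h => d2 (by linear_combination -h)
      have d4 : 2*w + (2*(k:ℂ)+1) ≠ 0 := fun h => d1 (by linear_combination h)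
      rw [mul_assoc 2 Complex.I z, ← hw, mul_sub, ← mul_div_assoc, ← mul_div_assoc]
      have : -Complex.I * Complex.I = 1 := by simp
      rw [this]
      field_simp
      ring
    · refine hs_congr (s1.div_const 2) (fun k => ?_) rfl
      push_cast
      have d3 : w - ((k:ℂ)+1) ≠ 0 := fun h => hint (2*(k+1)) (by push_cast; linear_combination -2*h)
      have d4 : w + ((k:ℂ)+1) ≠ 0 := fun h => hint (-(2*(k+1))) (by push_cast; linear_combination -2*h)
      have e1 : 2*w - (2*(k:ℂ)+1+1) = 2 * (w - (k+1)) := by ring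
      have e2 : 2*w + (2*(k:ℂ)+1+1) = 2 * (w + (k+1)) := by ring
      rw [e1, e2]
      field_simp
  have key := s2.unique s3
  rw [Complex.cot_pi_eq_exp_ratio, Complex.cot_pi_eq_exp_ratio] at key
  set q := Complex.exp (2 * Real.pi * Complex.I * w) with hq
  have hq2 : Complex.exp (2 * Real.pi * Complex.I * (2*w)) = q^2 := by
    rw [hq, ← Complex.exp_nat_mul]; congr 1; push_cast; ring
  rw [hq2] at key
  have hqe : q * Complex.exp (2*Real.pi*z) = 1 := by
    rw [hq, ← Complex.exp_add, hw]
    have : 2 * Real.pi * Complex.I * (Complex.I * z) + 2 * Real.pi * z = 0 := by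
      linear_combination (2 * Real.pi * z) * Complex.I_mul_I
    rw [this, Complex.exp_zero]
  have hq21 : q^2 ≠ 1 := by
    rw [← hq2, Ne, Complex.exp_eq_one_iff]
    rintro ⟨n, hn⟩
    apply hint n
    have hpi : (2 * Real.pi * Complex.I : ℂ) ≠ 0 := Complex.two_pi_I_ne_zero
    apply mul_left_cancel₀ hpi
    linear_combination -hn
  set E := Complex.exp (2*Real.pi*z) with hE
  have hE0 : E ≠ 0 := Complex.exp_ne_zero _
  have hqE : q = 1 / E := by field_simp; exact hqe
  have n1 : 1 - q^2 ≠ 0 := fun h => hq21 (by linear_combination -h)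
  have n2 : 1 - q ≠ 0 := fun h => n1 (by linear_combination (1+q)*h)
  have n3 : 1 + q ≠ 0 := fun h => n1 (by linear_combination (1-q)*h)
  have n4 : 1 + E ≠ 0 := fun h => n3 (by rw [hqE]; field_simp; linear_combination h)
  have hw0 : w ≠ 0 := fun h => hint 0 (by rw [h]; simp)
  have hval : IF 0 z = Complex.I * (Real.pi * ((q^2+1) / (Complex.I * (1 - q^2))) - 
      Real.pi * ((q+1) / (Complex.I * (1 - q))) / 2) := by
    have h5 : 1/(2*w) = 1/w/2 := by field_simp
    rw [h5] at key
    linear_combination (-Complex.I) * key + (IF 0 z) * Complex.I_mul_I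
  have h6 : IF 0 z = Real.pi / 2 * ((1 - q)/(1+q)) := by
    rw [hval]
    have h7 : 1 - q^2 = (1-q)*(1+q) := by ring
    rw [h7]
    field_simp
    ring
  rw [h6, hqE]
  have n5 : 1 + 1/E ≠ 0 := by rw [← hqE]; exact n3
  have : (1 - 1/E)/(1+1/E) = (E - 1)/(1+E) := by
    rw [div_eq_div_iff n5 n4]; field_simp; ring
  rw [this]; field_simp; ring


lemma strip_slit {z : ℂ} (hz : |z.im| < 1/2) {t : ℝ} (ht : 0 ≤ t) :
    1 + (t:ℂ) * Complex.exp (2*Real.pi*z) ∈ Complex.slitPlane := by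
  have hz' := abs_lt.1 hz
  have hpi := Real.pi_pos
  rw [Complex.mem_slitPlane_iff]
  have e1 : (1 + (t:ℂ) * Complex.exp (2*Real.pi*z)).re = 1 + t * (Real.exp (2*Real.pi*z.re) * Real.cos (2*Real.pi*z.im)) := by
    simp [Complex.exp_re]
  have e2 : (1 + (t:ℂ) * Complex.exp (2*Real.pi*z)).im = t * (Real.exp (2*Real.pi*z.re) * Real.sin (2*Real.pi*z.im)) := by
    simp [Complex.exp_im]
  by_cases h : (1 + (t:ℂ) * Complex.exp (2*Real.pi*z)).im = 0
  · left
    rw [e1]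
    rw [e2] at h
    rcases mul_eq_zero.1 h with h | h
    · rw [h]; norm_num
    · rcases mul_eq_zero.1 h with h | h
      · exact absurd h (Real.exp_pos _).ne'
      · have := (Real.sin_eq_zero_iff_of_lt_of_lt (x := 2*Real.pi*z.im) (by nlinarith) (by nlinarith)).1 h
        rw [this, Real.cos_zero]
        positivity
  · right; exact h

lemma strip_ne {z : ℂ} (hz : |z.im| < 1/2) : 1 + Complex.exp (2*Real.pi*z) ≠ 0 := by
  have := Complex.slitPlane_ne_zero (strip_slit hz (t := 1) zero_le_one)
  simpa using this

lemma strip_ne' {z : ℂ} (hz : |z.im| < 1/2) : -Complex.exp (2*Real.pi*z) ≠ 1 := by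
  intro h; exact strip_ne hz (by rw [← h]; ring)

lemma LiNeg_diff (m : ℕ) : DifferentiableOn ℂ (LiNeg m) {1}ᶜ := by
  induction m with
  | zero =>
    intro w hw
    have : 1 - w ≠ 0 := fun h => hw (by simp; linear_combination -h)
    unfold LiNeg
    exact (DifferentiableAt.div (by fun_prop) (by fun_prop) this).differentiableWithinAt
  | succ m ih =>
    unfold LiNeg
    exact differentiableOn_id.mul (ih.deriv isOpen_compl_singleton)

noncomputable def TT (m : ℕ) (z : ℂ) : ℂ := LiNeg m (-Complex.exp (2*Real.pi*z))

lemma exp_hd (z : ℂ) : HasDerivAt (fun z : ℂ => Complex.exp (2*Real.pi*z)) (2*Real.pi*Complex.exp (2*Real.pi*z)) z := by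
  have h : HasDerivAt (fun z : ℂ => 2*Real.pi*z) (2*Real.pi) z := by
    simpa using (hasDerivAt_id z).const_mul (2*Real.pi : ℂ)
  have := h.cexp
  rwa [mul_comm (Complex.exp _)] at this

lemma TT_deriv (m : ℕ) {z : ℂ} (hz : |z.im| < 1/2) : HasDerivAt (TT m) (2*Real.pi*TT (m+1) z) z := by
  have h1 : HasDerivAt (LiNeg m) (deriv (LiNeg m) (-Complex.exp (2*Real.pi*z))) (-Complex.exp (2*Real.pi*z)) :=
    ((LiNeg_diff m).differentiableAt (isOpen_compl_singleton.mem_nhds (strip_ne' hz))).hasDerivAt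
  have h2 := h1.comp z (exp_hd z).neg
  have e : 2*Real.pi*TT (m+1) z = deriv (LiNeg m) (-Complex.exp (2*Real.pi*z)) * (-(2*Real.pi*Complex.exp (2*Real.pi*z))) := by
    unfold TT
    rw [LiNeg]; ring
  rw [e]
  exact h2

lemma strip_open : IsOpen {z : ℂ | |z.im| < 1/2} :=
  isOpen_lt (Complex.continuous_im.abs) continuous_const

lemma deriv_uniq {f g : ℂ → ℂ} {f' g' : ℂ} (h : ∀ z : ℂ, |z.im| < 1/2 → f z = g z) {z : ℂ} (hz : |z.im| < 1/2)
    (hf : HasDerivAt f f' z) (hg : HasDerivAt g g' z) : f' = g' := by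
  have : f =ᶠ[𝓝 z] g := by
    filter_upwards [strip_open.mem_nhds hz] with w hw using h w hw
  exact hf.unique (hg.congr_of_eventuallyEq this)

lemma IC_of_IF (n : ℕ) (c : ℂ) (h : ∀ z : ℂ, |z.im| < 1/2 → IF n z = (-1)^(n+1) * Real.pi^(2*n+1) * TT (2*n) z + c) :
    ∀ z : ℂ, |z.im| < 1/2 → IC n z = (-1)^(n+1) * Real.pi^(2*n+2) * TT (2*n+1) z := by
  intro z hz
  have := deriv_uniq h hz (IF_deriv n hz) (((TT_deriv (2*n) hz).const_mul ((-1)^(n+1) * (Real.pi:ℂ)^(2*n+1) : ℂ)).add_const c)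
  linear_combination this / 2

lemma IF_succ_of_IC (n : ℕ) (h : ∀ z : ℂ, |z.im| < 1/2 → IC n z = (-1)^(n+1) * Real.pi^(2*n+2) * TT (2*n+1) z) :
    ∀ z : ℂ, |z.im| < 1/2 → IF (n+1) z = (-1)^(n+2) * Real.pi^(2*n+3) * TT (2*n+2) z := by
  intro z hz
  have := deriv_uniq h hz (IC_deriv n hz) (((TT_deriv (2*n+1) hz).const_mul ((-1)^(n+1) * (Real.pi:ℂ)^(2*n+2) : ℂ)))
  linear_combination -this / 2

lemma IF_zero' : ∀ z : ℂ, |z.im| < 1/2 → IF 0 z = - Real.pi * TT 0 z + (-(Real.pi/2)) := by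
  intro z hz
  rw [IF0_val hz]
  unfold TT LiNeg
  rw [sub_neg_eq_add]; ring

lemma IF_succ_val (n : ℕ) : ∀ z : ℂ, |z.im| < 1/2 → IF (n+1) z = (-1)^(n+2) * Real.pi^(2*n+3) * TT (2*n+2) z := by
  induction n with
  | zero =>
    refine IF_succ_of_IC 0 (IC_of_IF 0 (-(Real.pi/2)) fun z hz => ?_)
    rw [IF_zero' z hz]; simp
  | succ n ih =>
    refine IF_succ_of_IC (n+1) (IC_of_IF (n+1) 0 fun z hz => ?_)
    rw [ih z hz]; ring_nf


noncomputable def phi (z : ℂ) : ℂ := Li2 (-Complex.exp (2*Real.pi*z))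

noncomputable def fL (z : ℂ) (t : ℝ) : ℂ := Complex.log (1 + (t:ℂ) * Complex.exp (2*Real.pi*z)) / (t:ℂ)
noncomputable def fL' (z : ℂ) (t : ℝ) : ℂ := 2*Real.pi*Complex.exp (2*Real.pi*z) / (1 + (t:ℂ) * Complex.exp (2*Real.pi*z))

lemma phi_eq (z : ℂ) : phi z = -∫ t in (0:ℝ)..1, fL z t := by
  unfold phi Li2 fL
  simp

lemma log_hd_t {z : ℂ} (hz : |z.im| < 1/2) {t : ℝ} (ht : 0 ≤ t) :
    HasDerivAt (fun t : ℝ => Complex.log (1 + (t:ℂ) * Complex.exp (2*Real.pi*z)))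
      (Complex.exp (2*Real.pi*z) / (1 + (t:ℂ) * Complex.exp (2*Real.pi*z))) t := by
  have h1 : HasDerivAt (fun t : ℝ => 1 + (t:ℂ) * Complex.exp (2*Real.pi*z)) (Complex.exp (2*Real.pi*z)) t := by
    have := ((Complex.ofRealCLM.hasDerivAt (x := t)).mul_const (Complex.exp (2*Real.pi*z))).const_add 1
    simpa using this
  exact h1.clog_real (strip_slit hz ht)

lemma log_hd_z {z : ℂ} (hz : |z.im| < 1/2) {t : ℝ} (ht : 0 ≤ t) :
    HasDerivAt (fun z : ℂ => Complex.log (1 + (t:ℂ) * Complex.exp (2*Real.pi*z)))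
      (t * fL' z t) z := by
  have h1 := (((exp_hd z).const_mul (t:ℂ)).const_add 1).clog (strip_slit hz ht)
  have e : t * fL' z t = (t:ℂ) * (2*Real.pi*Complex.exp (2*Real.pi*z)) / (1 + (t:ℂ) * Complex.exp (2*Real.pi*z)) := by
    unfold fL'; ring
  rw [e]; exact h1

lemma fL_int {z : ℂ} (hz : |z.im| < 1/2) : IntervalIntegrable (fL z) volume 0 1 := by
  set g : ℝ → ℂ := fun t : ℝ => Complex.log (1 + (t:ℂ) * Complex.exp (2*Real.pi*z)) with hg
  have hc : ContinuousOn (dslope g 0) (Icc 0 1) := by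
    intro t ht
    rcases eq_or_ne t 0 with rfl | h0
    · exact (continuousAt_dslope_same.2 (log_hd_t hz le_rfl).differentiableAt).continuousWithinAt
    · exact ((continuousAt_dslope_of_ne h0).2 (log_hd_t hz ht.1).continuousAt).continuousWithinAt
  have h1 : IntervalIntegrable (dslope g 0) volume 0 1 := by
    apply ContinuousOn.intervalIntegrable
    rwa [uIcc_of_le zero_le_one]
  refine h1.congr ?_
  intro t ht
  rw [uIoc_of_le zero_le_one] at ht
  rw [dslope_of_ne _ ht.1.ne']
  simp [slope, hg, fL, div_eq_inv_mul]

lemma phi_deriv {z : ℂ} (hz : |z.im| < 1/2) :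
    HasDerivAt phi (-(2*Real.pi*Complex.log (1 + Complex.exp (2*Real.pi*z)))) z := by
  obtain ⟨r, hr, hrs⟩ := Metric.nhds_basis_closedBall.mem_iff.1 (strip_open.mem_nhds hz)
  have hcont : ContinuousOn (fun p : ℂ × ℝ => fL' p.1 p.2) (Metric.closedBall z r ×ˢ Icc 0 1) := by
    unfold fL'
    apply ContinuousOn.div
    · fun_prop
    · fun_prop
    · rintro ⟨w, t⟩ ⟨hw, ht⟩
      exact Complex.slitPlane_ne_zero (strip_slit (hrs hw) ht.1)
  obtain ⟨M, hM⟩ := ((isCompact_closedBall z r).prod isCompact_Icc).exists_bound_of_continuousOn hcont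
  have hmeas : ∀ w, Measurable (fL w) := by
    intro w; unfold fL; fun_prop
  have hmeas' : ∀ w, Measurable (fL' w) := by
    intro w; unfold fL'; fun_prop
  have h := intervalIntegral.hasDerivAt_integral_of_dominated_loc_of_deriv_le (F := fL) (F' := fL') (μ := volume)
    (a := 0) (b := 1) (bound := fun _ => M) (Metric.closedBall_mem_nhds z hr)
    (Eventually.of_forall fun w => (hmeas w).aestronglyMeasurable) (fL_int hz) (hmeas' z).aestronglyMeasurable
    (ae_of_all _ fun t ht w hw => by
      rw [uIoc_of_le zero_le_one] at ht
      exact hM (w, t) ⟨hw, ht.1.le, ht.2⟩) (by simp)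
    (ae_of_all _ fun t ht w hw => by
      rw [uIoc_of_le zero_le_one] at ht
      have h1 := (log_hd_z (hrs hw) ht.1.le).div_const (t:ℂ)
      have ht0 : (t:ℂ) ≠ 0 := by exact_mod_cast ht.1.ne'
      rwa [mul_div_cancel_left₀ _ ht0] at h1)
  have e : ∫ t in (0:ℝ)..1, fL' z t = 2*Real.pi*Complex.log (1 + Complex.exp (2*Real.pi*z)) := by
    have : ∀ t ∈ uIcc (0:ℝ) 1, HasDerivAt (fun t : ℝ => 2*Real.pi*Complex.log (1 + (t:ℂ) * Complex.exp (2*Real.pi*z))) (fL' z t) t := by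
      intro t ht
      rw [uIcc_of_le zero_le_one] at ht
      have := (log_hd_t hz ht.1).const_mul (2*Real.pi : ℂ)
      rwa [← mul_div_assoc] at this
    rw [intervalIntegral.integral_eq_sub_of_hasDerivAt this h.1]
    simp
  rw [← e, show phi = fun z => -∫ t in (0:ℝ)..1, fL z t from funext phi_eq]
  exact h.2.neg

lemma alt_sum : HasSum (fun n : ℕ => (-1:ℝ)^n / ((n:ℝ)+1)^2) (Real.pi^2/12) := by
  have h := hasSum_one_div_nat_pow_mul_cos (k := 1) one_ne_zero (x := 1/2) (by constructor <;> norm_num)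
  have h2 := ((hasSum_nat_add_iff' 1).2 h).neg
  have hf : (fun n : ℕ => (-1:ℝ)^n / ((n:ℝ)+1)^2) = fun n : ℕ => -(1 / (((n+1:ℕ)):ℝ) ^ (2 * 1) * Real.cos (2 * Real.pi * ((n+1:ℕ):ℝ) * (1/2))) := by
    funext n
    have : 2 * Real.pi * ((n+1:ℕ):ℝ) * (1/2) = ((n+1:ℕ):ℝ) * Real.pi := by ring
    rw [this, Real.cos_nat_mul_pi]
    push_cast
    rw [pow_succ]; ring
  rw [hf]
  have hB : (Polynomial.map (algebraMap ℚ ℝ) (Polynomial.bernoulli (2 * 1))).eval (1/2:ℝ) = -1/12 := by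
    simp [Polynomial.bernoulli, Finset.sum_range_succ, Nat.choose, bernoulli_one, bernoulli_two]
    norm_num
  rw [hB] at h2
  have hv : Real.pi^2/12 = -((-1:ℝ) ^ (1 + 1) * (2 * Real.pi) ^ (2 * 1) / 2 / (Nat.factorial (2 * 1)) * (-1/12) -
      ∑ i ∈ Finset.range 1, 1 / (i:ℝ) ^ (2 * 1) * Real.cos (2 * Real.pi * i * (1/2))) := by
    simp [Nat.factorial]; ring
  rw [hv]
  exact h2

lemma int_log : ∫ t in (0:ℝ)..1, Real.log (1+t)/t = Real.pi^2/12 := by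
  rw [intervalIntegral.integral_of_le zero_le_one, integral_Ioc_eq_integral_Ioo]
  have hv : ∀ n : ℕ, ∫ t in Ioo (0:ℝ) 1, t^n = 1/((n:ℝ)+1) := by
    intro n
    rw [← integral_Ioc_eq_integral_Ioo, ← intervalIntegral.integral_of_le zero_le_one, integral_pow]
    simp
  have hi : ∀ n : ℕ, IntegrableOn (fun t : ℝ => t^n) (Ioo (0:ℝ) 1) := by
    intro n
    exact ((continuous_pow n).continuousOn.integrableOn_Icc (a := 0) (b := 1)).mono_set Ioo_subset_Icc_self
  have h := hasSum_integral_of_summable_integral_norm (F := fun (n:ℕ) (t:ℝ) => (-1:ℝ)^n/((n:ℝ)+1) * t^n)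
    (μ := volume.restrict (Ioo (0:ℝ) 1)) (fun n => (hi n).const_mul _) ?_
  · have e : ∀ n : ℕ, ∫ t in Ioo (0:ℝ) 1, (-1:ℝ)^n/((n:ℝ)+1) * t^n = (-1:ℝ)^n / ((n:ℝ)+1)^2 := by
      intro n
      rw [integral_const_mul, hv]; field_simp
    simp_rw [e] at h
    rw [h.unique alt_sum |>.symm]
    refine setIntegral_congr_fun measurableSet_Ioo fun t ht => ?_
    have h3 := (Real.hasSum_pow_div_log_of_abs_lt_one (x := -t) (by rw [abs_neg, abs_of_pos ht.1]; exact ht.2)).mul_left (-1/t)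
    have hf : (fun n : ℕ => (-1:ℝ)^n/((n:ℝ)+1) * t^n) = fun n : ℕ => -1/t * ((-t)^(n+1)/((n:ℝ)+1)) := by
      funext n
      have := ht.1.ne'
      rw [neg_pow t, pow_succ, pow_succ]; field_simp
    beta_reduce
    rw [hf, h3.tsum_eq, sub_neg_eq_add]; ring
  · have : ∀ n : ℕ, ∫ t in Ioo (0:ℝ) 1, ‖(-1:ℝ)^n/((n:ℝ)+1) * t^n‖ = 1/((n:ℝ)+1)^2 := by
      intro n
      rw [setIntegral_congr_fun (g := fun t => 1/((n:ℝ)+1) * t^n) measurableSet_Ioo, integral_const_mul, hv]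
      · field_simp
      · intro t ht
        have h1 : (0:ℝ) < (n:ℝ)+1 := by positivity
        simp [abs_of_pos ht.1, abs_of_pos h1]
    simp_rw [this]
    have := (summable_nat_add_iff 1).2 (Real.summable_one_div_nat_pow.2 (one_lt_two))
    simpa using this

lemma phi_zero : phi 0 = -(Real.pi^2/12) := by
  have : (∫ t in (0:ℝ)..1, fL 0 t) = ((∫ t in (0:ℝ)..1, Real.log (1+t)/t : ℝ) : ℂ) := by
    rw [← intervalIntegral.integral_ofReal]
    refine intervalIntegral.integral_congr fun t ht => ?_
    rw [uIcc_of_le zero_le_one] at ht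
    have h1 : (0:ℝ) ≤ 1 + t := by linarith [ht.1]
    simp [fL, Complex.ofReal_log h1]
  rw [phi_eq, this, int_log]; push_cast; rfl

lemma strip_conv : Convex ℝ {z : ℂ | |z.im| < 1/2} := by
  have : {z : ℂ | |z.im| < 1/2} = Complex.imLm ⁻¹' (Ioo (-(1/2)) (1/2)) := by
    ext z; simp [abs_lt]
  rw [this]
  exact (convex_Ioo _ _).linear_preimage _

lemma strip_const {f : ℂ → ℂ} (hf : ∀ z : ℂ, |z.im| < 1/2 → HasDerivAt f 0 z) {z : ℂ} (hz : |z.im| < 1/2) : f z = f 0 := by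
  refine strip_open.is_const_of_deriv_eq_zero strip_conv.isPreconnected
    (fun w hw => (hf w hw).differentiableAt.differentiableWithinAt) (fun w hw => (hf w hw).deriv) hz ?_
  simp

lemma hd_log1 {z : ℂ} (hz : |z.im| < 1/2) : HasDerivAt (fun z : ℂ => Complex.log (1 + Complex.exp (2*Real.pi*z)))
    (2*Real.pi*Complex.exp (2*Real.pi*z) / (1 + Complex.exp (2*Real.pi*z))) z := by
  have := log_hd_z hz (t := 1) zero_le_one
  simpa [fL'] using this

lemma IB_val : ∀ z : ℂ, |z.im| < 1/2 → IB z = 2*Real.pi*z - 2 * Complex.log (1 + Complex.exp (2*Real.pi*z)) := by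
  intro z hz
  have h := strip_const (f := fun z => IB z - (2*Real.pi*z - 2 * Complex.log (1 + Complex.exp (2*Real.pi*z)))) ?_ hz
  · have h0 : IB 0 - (2*Real.pi*0 - 2 * Complex.log (1 + Complex.exp (2*Real.pi*0))) = 0 := by
      rw [IB_zero]
      have : (1 + 1 : ℂ) = ((2:ℝ):ℂ) := by norm_num
      rw [mul_zero, Complex.exp_zero, this, Complex.ofReal_log (by norm_num)]
      ring
    beta_reduce at h
    rw [h0] at h
    linear_combination h
  · intro w hw
    have h1 : HasDerivAt (fun z : ℂ => 2*Real.pi*z) (2*Real.pi) w := by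
      simpa using (hasDerivAt_id w).const_mul (2*Real.pi : ℂ)
    have h2 := (IB_deriv hw).sub (h1.sub ((hd_log1 hw).const_mul 2))
    have e : -4 * IF 0 w - (2*Real.pi - 2 * (2*Real.pi*Complex.exp (2*Real.pi*w) / (1 + Complex.exp (2*Real.pi*w)))) = 0 := by
      rw [IF0_val hw]; ring
    rw [e] at h2
    exact h2

lemma IA_val : ∀ z : ℂ, |z.im| < 1/2 → IA z = Real.pi*z^2 + Real.pi/12 + phi z / Real.pi := by
  intro z hz
  have hpi : (Real.pi : ℂ) ≠ 0 := by exact_mod_cast Real.pi_ne_zero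
  have h := strip_const (f := fun z => IA z - (Real.pi*z^2 + Real.pi/12 + phi z / Real.pi)) ?_ hz
  · have h0 : IA 0 - (Real.pi*0^2 + Real.pi/12 + phi 0 / Real.pi) = 0 := by
      rw [IA_zero, phi_zero]
      field_simp
      ring
    beta_reduce at h
    rw [h0] at h
    linear_combination h
  · intro w hw
    have h1 : HasDerivAt (fun z : ℂ => Real.pi*z^2+Real.pi/12) (2*Real.pi*w) w := by
      have := ((hasDerivAt_pow 2 w).const_mul (Real.pi : ℂ)).add_const (Real.pi/12 : ℂ)
      convert! this using 1
      simp; ring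
    have h2 := (IA_deriv hw).sub (h1.add ((phi_deriv hw).div_const Real.pi))
    have e : IB w - (2*Real.pi*w + (-(2*Real.pi*Complex.log (1 + Complex.exp (2*Real.pi*w)))) / Real.pi) = 0 := by
      rw [IB_val w hw]; field_simp; ring
    rw [e] at h2
    exact h2


noncomputable def hh (β : ℝ) (z : ℂ) (x : ℝ) : ℂ :=
  (Complex.sin (2 * (x:ℂ) * z) / (2 * (Real.sinh x : ℂ) * (Real.sinh (β * x) : ℂ)) - z / ((β:ℂ) * (x:ℂ))) / (x:ℂ)

lemma Lb_hh {b : ℝ} (hb : 0 < b) (z : ℂ) : Lb b (z/(b:ℂ)) = Complex.I * ∫ x in Ioi (0:ℝ), hh (b^2) z x := by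
  unfold Lb
  congr 1
  have hb' : (b:ℂ) ≠ 0 := by exact_mod_cast hb.ne'
  set g : ℝ → ℂ := fun y => (Complex.sin (2 * (y:ℂ) * (z/(b:ℂ))) / (2 * (Real.sinh (y / b) : ℂ) * (Real.sinh (b * y) : ℂ))
      - (z/(b:ℂ)) / (y:ℂ)) / (y:ℂ) with hg
  have h := integral_comp_mul_left_Ioi g 0 hb
  rw [mul_zero] at h
  have h2 : ∫ y in Ioi (0:ℝ), g y = (b:ℂ) * ∫ x in Ioi (0:ℝ), g (b * x) := by
    rw [h, Complex.real_smul, Complex.ofReal_inv, mul_inv_cancel_left₀ hb']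
  rw [h2, ← integral_const_mul]
  refine setIntegral_congr_fun measurableSet_Ioi fun x (hx : 0 < x) => ?_
  have hx' : (x:ℂ) ≠ 0 := by exact_mod_cast hx.ne'
  have e1 : b * x / b = x := by field_simp
  have e2 : b * (b * x) = b^2 * x := by ring
  have e3 : 2 * ((b * x : ℝ):ℂ) * (z/(b:ℂ)) = 2 * (x:ℂ) * z := by push_cast; field_simp
  simp only [hg, hh]
  rw [e1, e2, e3]
  generalize Complex.sin (2 * (x:ℂ) * z) / (2 * (Real.sinh x : ℂ) * (Real.sinh (b^2 * x) : ℂ)) = A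
  push_cast
  field_simp

noncomputable def RR (N : ℕ) (u : ℝ) : ℝ := 1 / Real.sinh u - (∑ n ∈ Finset.range (N+1), 2 * cc n * u^(2*n)) / u

noncomputable def EE (N : ℕ) (β : ℝ) (z : ℂ) (x : ℝ) : ℂ :=
  Complex.sin (2 * (x:ℂ) * z) / (2 * (Real.sinh x : ℂ) * (x:ℂ)) * (RR N (β * x) : ℂ)

lemma hh_eq (N : ℕ) {β : ℝ} (hβ : 0 < β) (z : ℂ) {x : ℝ} (hx : 0 < x) :
    hh β z x = (1/(2*(β:ℂ))) * gA z x + (∑ n ∈ Finset.range N, (cc (n+1) : ℂ) * (β:ℂ)^(2*n+1) * fF n z x) + EE N β z x := by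
  have hx' : (x:ℂ) ≠ 0 := by exact_mod_cast hx.ne'
  have hβ' : (β:ℂ) ≠ 0 := by exact_mod_cast hβ.ne'
  have hs : (Real.sinh x : ℂ) ≠ 0 := by exact_mod_cast (Real.sinh_pos_iff.2 hx).ne'
  have hs2 : (Real.sinh (β*x) : ℂ) ≠ 0 := by exact_mod_cast (Real.sinh_pos_iff.2 (mul_pos hβ hx)).ne'
  unfold EE RR
  rw [Finset.sum_range_succ', cc_zero]
  have hsum : (∑ n ∈ Finset.range N, (cc (n+1) : ℂ) * (β:ℂ)^(2*n+1) * fF n z x) =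
      Complex.sin (2 * (x:ℂ) * z) / (2 * (Real.sinh x : ℂ) * (x:ℂ)) *
        ((∑ n ∈ Finset.range N, 2 * (cc (n+1) : ℂ) * ((β:ℂ)*x)^(2*(n+1))) / ((β:ℂ) * x)) := by
    rw [Finset.sum_div, Finset.mul_sum]
    refine Finset.sum_congr rfl fun n _ => ?_
    unfold fF
    rw [mul_add, pow_add, mul_pow]
    field_simp
    ring
  rw [hsum]
  unfold hh gA
  simp only [Complex.ofReal_sub, Complex.ofReal_div, Complex.ofReal_add, Complex.ofReal_sum, Complex.ofReal_mul,
    Complex.ofReal_pow, Complex.ofReal_one, Complex.ofReal_ofNat]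
  generalize (∑ n ∈ Finset.range N, 2 * (cc (n+1) : ℂ) * ((β:ℂ)*x)^(2*(n+1))) = S
  generalize (Real.sinh x : ℂ) = s at *
  generalize (Real.sinh (β*x) : ℂ) = s2 at *
  generalize Complex.sin (2 * (x:ℂ) * z) = q
  field_simp
  ring

lemma EE_meas (N : ℕ) (β : ℝ) (z : ℂ) : Measurable (EE N β z) := by
  unfold EE RR
  have := meas_sin
  have := meas_sinh
  have h3 : Measurable Real.sinh := Real.continuous_sinh.measurable
  fun_prop

lemma EE_bound (M : ℕ) {K : ℝ} (hK : ∀ u : ℝ, 0 < u → |RR (M+1) u| ≤ K * u^(2*(M+1)+1)) {β : ℝ} (hβ : 0 < β) {z : ℂ} {η : ℝ}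
    (hz : |z.im| ≤ η) {x : ℝ} (hx : 0 < x) :
    ‖EE (M+1) β z x‖ ≤ (K * β^(2*(M+1)+1) / 2) * (x^(2*M+1+1) * Real.exp (2*η*x) / Real.sinh x) := by
  have hs := Real.sinh_pos_iff.2 hx
  unfold EE
  rw [norm_mul, norm_div, norm_mul, norm_mul, Complex.norm_real, Complex.norm_real, Complex.norm_real, Complex.norm_ofNat,
    Real.norm_of_nonneg hs.le, Real.norm_of_nonneg hx.le, Real.norm_eq_abs]
  calc _ ≤ Real.exp (2*η*x) / (2 * Real.sinh x * x) * (K * (β*x)^(2*(M+1)+1)) := by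
        gcongr
        · exact norm_sin_le_exp _ (im_two_x hx hz)
        · exact hK _ (mul_pos hβ hx)
    _ = _ := by
        rw [mul_pow, show 2*(M+1)+1 = (2*M+1+1)+1 by ring, pow_succ x]
        field_simp

lemma Lb_decomp (M : ℕ) {K : ℝ} (hK : ∀ u : ℝ, 0 < u → |RR (M+1) u| ≤ K * u^(2*(M+1)+1)) {b : ℝ} (hb : 0 < b) {z : ℂ} {η : ℝ}
    (hη : η < 1/2) (hz : |z.im| ≤ η) :
    ∃ e : ℂ, ‖e‖ ≤ (K * (b^2)^(2*(M+1)+1) / 2) * (∫ x in Ioi (0:ℝ), x^(2*M+1+1) * Real.exp (2*η*x) / Real.sinh x) ∧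
    Lb b (z/(b:ℂ)) = Complex.I * ((1/(2*(b:ℂ)^2)) * IA z
      + (∑ n ∈ Finset.range (M+1), (cc (n+1) : ℂ) * ((b:ℂ)^2)^(2*n+1) * IF n z) + e) := by
  have hz' : |z.im| < 1/2 := hz.trans_lt hη
  have hb2 : 0 < b^2 := by positivity
  have hker := (kernel_integrable (2*M+1) (a := 2*η) (by linarith)).const_mul (K * (b^2)^(2*(M+1)+1) / 2)
  have hbd : ∀ᵐ x ∂(volume.restrict (Ioi (0:ℝ))), ‖EE (M+1) (b^2) z x‖ ≤ (K * (b^2)^(2*(M+1)+1) / 2) * (x^(2*M+1+1) * Real.exp (2*η*x) / Real.sinh x) :=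
    (ae_restrict_iff' measurableSet_Ioi).2 (ae_of_all _ fun x hx => EE_bound M hK hb2 hz hx)
  have hEint : IntegrableOn (EE (M+1) (b^2) z) (Ioi 0) :=
    Integrable.mono' hker (EE_meas _ _ _).aestronglyMeasurable hbd
  refine ⟨∫ x in Ioi (0:ℝ), EE (M+1) (b^2) z x, ?_, ?_⟩
  · rw [← integral_const_mul]
    exact norm_integral_le_of_norm_le hker hbd
  · rw [Lb_hh hb]
    congr 1
    have hA : IntegrableOn (fun x => (1/(2*((b^2:ℝ):ℂ))) * gA z x) (Ioi 0) := (dom_gA.int hz').const_mul _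
    have hF : ∀ n ∈ Finset.range (M+1), IntegrableOn (fun x => (cc (n+1) : ℂ) * ((b^2:ℝ):ℂ)^(2*n+1) * fF n z x) (Ioi 0) :=
      fun n _ => ((dom_fF n).int hz').const_mul _
    have hAF : IntegrableOn (fun x => (1/(2*((b^2:ℝ):ℂ))) * gA z x + ∑ n ∈ Finset.range (M+1), (cc (n+1) : ℂ) * ((b^2:ℝ):ℂ)^(2*n+1) * fF n z x) (Ioi 0) :=
      hA.add (integrable_finsetSum _ hF)
    rw [setIntegral_congr_fun measurableSet_Ioi fun x hx => hh_eq (M+1) hb2 z hx]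
    rw [integral_add hAF hEint, integral_add hA (integrable_finsetSum _ hF),
      integral_finsetSum _ hF, integral_const_mul]
    simp_rw [integral_const_mul]
    push_cast
    rfl

lemma IF_val (n : ℕ) {z : ℂ} (hz : |z.im| < 1/2) :
    IF n z = (-1)^(n+1) * Real.pi^(2*n+1) * TT (2*n) z + (if n = 0 then -(Real.pi/2) else 0) := by
  cases n with
  | zero => rw [IF_zero' z hz]; simp
  | succ n => rw [IF_succ_val n z hz]; simp; ring_nf

lemma cc_one : cc 1 = -1/12 := by
  unfold cc
  norm_num [bernoulli_two]

lemma main_id (M : ℕ) {β : ℂ} (hβ : β ≠ 0) {z : ℂ} (hz : |z.im| < 1/2) :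
    Complex.I * ((1/(2*β)) * IA z + (∑ n ∈ Finset.range (M+1), (cc (n+1) : ℂ) * β^(2*n+1) * IF n z))
      - (Real.pi:ℂ)*Complex.I*z^2/(2*β) - (Real.pi:ℂ)*Complex.I*(β + β⁻¹)/24
      + ∑ n ∈ Finset.range (M+1+1), ((1 - (2:ℂ)^(2*(n:ℤ)-1)) * ((bernoulli (2*n) : ℚ) : ℂ)
                  / (Nat.factorial (2*n) : ℂ))
                * LiIdx n (-Complex.exp (2*(Real.pi:ℂ)*z))
                * ((Real.pi:ℂ)*Complex.I*β) ^ (2*(n:ℤ)-1) = 0 := by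
  have hpi : (Real.pi : ℂ) ≠ 0 := by exact_mod_cast Real.pi_ne_zero
  have hcc : ∀ n : ℕ, ((1 - (2:ℂ)^(2*(n:ℤ)-1)) * ((bernoulli (2*n) : ℚ) : ℂ) / (Nat.factorial (2*n) : ℂ)) = (cc n : ℂ) := by
    intro n; unfold cc; push_cast; rfl
  have hsum : (∑ n ∈ Finset.range (M+1), (cc (n+1) : ℂ) * β^(2*n+1) * IF n z) =
      (∑ n ∈ Finset.range (M+1), (cc (n+1) : ℂ) * β^(2*n+1) * ((-1)^(n+1) * Real.pi^(2*n+1) * TT (2*n) z)) + β * Real.pi / 24 := by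
    simp_rw [IF_val _ hz, mul_add, Finset.sum_add_distrib]
    congr 1
    rw [Finset.sum_range_succ']
    simp [cc_one]; ring
  have hsum2 : ∑ n ∈ Finset.range (M+1+1), (cc n : ℂ)
                * LiIdx n (-Complex.exp (2*(Real.pi:ℂ)*z))
                * ((Real.pi:ℂ)*Complex.I*β) ^ (2*(n:ℤ)-1) =
      -Complex.I * (∑ n ∈ Finset.range (M+1), (cc (n+1) : ℂ) * β^(2*n+1) * ((-1)^(n+1) * Real.pi^(2*n+1) * TT (2*n) z))
       + phi z / (2 * (Real.pi * Complex.I * β)) := by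
    rw [Finset.sum_range_succ', Finset.mul_sum]
    congr 1
    · refine Finset.sum_congr rfl fun n _ => ?_
      have e1 : (2*((n+1:ℕ):ℤ)-1) = ((2*n+1:ℕ):ℤ) := by push_cast; ring
      have e2 : LiIdx (n+1) (-Complex.exp (2*(Real.pi:ℂ)*z)) = TT (2*n) z := by
        unfold LiIdx TT
        rw [if_neg (Nat.succ_ne_zero n), show 2*(n+1)-2 = 2*n by omega]
      rw [e1, e2, zpow_natCast, mul_pow, mul_pow, pow_succ Complex.I, pow_mul Complex.I, Complex.I_sq]
      ring
    · rw [cc_zero]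
      have e2 : LiIdx 0 (-Complex.exp (2*(Real.pi:ℂ)*z)) = phi z := by
        unfold LiIdx phi; rw [if_pos rfl]
      rw [e2]
      norm_num
      field_simp
      linear_combination (-phi z) * Complex.I_sq
  simp_rw [hcc]
  rw [hsum2, hsum, IA_val z hz]
  generalize (∑ n ∈ Finset.range (M+1), (cc (n+1) : ℂ) * β^(2*n+1) * ((-1)^(n+1) * Real.pi^(2*n+1) * TT (2*n) z)) = S
  have hI := Complex.I_sq
  have e3 : phi z / (2 * (Real.pi * Complex.I * β)) = -Complex.I * phi z / (2 * Real.pi * β) := by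
    field_simp
    linear_combination (phi z) * hI
  rw [e3]
  field_simp
  ring

end Helpers

/-- Asymptotics of `ln s_b(z/b)` = `L_b(z/b)`. -/
theorem Lb_asymptotic_expansion (N : ℕ) (hN : 1 ≤ N) (δ : ℝ) (hδ : δ ∈ Set.Ioo (0:ℝ) (1/2)) :
    ∃ C > (0:ℝ), ∃ b₀ ∈ Set.Ioo (0:ℝ) 1, ∀ b ∈ Set.Ioo (0:ℝ) b₀, ∀ z : ℂ, |z.im| ≤ 1/2 - δ →
      ‖Lb b (z/(b:ℂ)) - (Real.pi:ℂ)*Complex.I*z^2/(2*(b:ℂ)^2)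
          - (Real.pi:ℂ)*Complex.I*((b:ℂ)^2 + ((b:ℂ)^2)⁻¹)/24
          + ∑ n ∈ Finset.range (N+1),
              ((1 - (2:ℂ)^(2*(n:ℤ)-1)) * ((bernoulli (2*n) : ℚ) : ℂ)
                  / (Nat.factorial (2*n) : ℂ))
                * LiIdx n (-Complex.exp (2*(Real.pi:ℂ)*z))
                * ((Real.pi:ℂ)*Complex.I*(b:ℂ)^2) ^ (2*(n:ℤ)-1)‖
        ≤ C * b^(4*N+2) := by
  obtain ⟨M, rfl⟩ : ∃ M, N = M + 1 := ⟨N - 1, by omega⟩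
  obtain ⟨K, hK0, hK⟩ := sinh_rem (M+1)
  have hη : 1/2 - δ < 1/2 := by linarith [hδ.1]
  set J := ∫ x in Set.Ioi (0:ℝ), x^(2*M+1+1) * Real.exp (2*(1/2 - δ)*x) / Real.sinh x with hJ
  have hJ0 : 0 ≤ J := setIntegral_nonneg measurableSet_Ioi fun x (hx : 0 < x) => by
    have := Real.sinh_pos_iff.2 hx
    positivity
  refine ⟨K / 2 * J + 1, by positivity, 1/2, by norm_num, fun b hb z hz => ?_⟩
  have hb0 : 0 < b := hb.1
  have hb' : ((b:ℂ)^2) ≠ 0 := by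
    have : (b:ℂ) ≠ 0 := by exact_mod_cast hb0.ne'
    exact pow_ne_zero 2 this
  obtain ⟨e, he, hL⟩ := Lb_decomp M (K := K) hK hb0 hη hz
  have hid := main_id M hb' (hz.trans_lt hη)
  rw [hL]
  have h3 : ∀ A B C D e : ℂ, Complex.I * A - B - C + D = 0 → Complex.I * (A + e) - B - C + D = Complex.I * e := by
    intro A B C D e h
    linear_combination h
  rw [h3 _ _ _ _ _ hid, norm_mul, Complex.norm_I, one_mul]
  refine he.trans ?_
  rw [← pow_mul, show 2 * (2*(M+1)+1) = 4*(M+1)+2 by ring]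
  have : 0 < b^(4*(M+1)+2) := by positivity
  calc _ = (K/2*J) * b^(4*(M+1)+2) := by ring
    _ ≤ _ := by gcongr; linarith
end
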